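/- arXiv:2008.11501 — 2 statements merged into one kernel-verified Lean document; each statement's English description precedes it below -/
import Mathlib

section
/- Let A ∈ ℂ^{n×n}, B, C ∈ ℂ^{n×ℓ}, and let f be a polynomial. Let E ⊆ ℂ be a compact convex set containing the numerical ranges W(A) and W(A+BC*). Let U be an orthonormal basis of K_m(A,B) and V be an orthonormal basis of K_m(A*,C); set G = U*AU, H = V*A*V, T = [[G, (U*B)(V*C)*], [0, H* + (V*B)(V*C)*]], and let X_m(f) be the (1,2) block of f(T). Then ‖f(A+BC*) − f(A) − U X_m(f) V*‖_F ≤ 2(1+√2)² · ‖BC*‖_F · inf_{p ∈ Π_{m−1}} sup_{z∈E} |f′(z) − p(z)|, where the infimum is over all polynomials p of degree at most m−1. -/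
open Polynomial Matrix

/-- The block Krylov subspace `K_m(A, B)`: the span of the columns of
`B, A*B, …, A^(m-1)*B`. -/
noncomputable def Krylov {n : ℕ} {ι : Type*} (m : ℕ) (A : Matrix (Fin n) (Fin n) ℂ)
    (B : Matrix (Fin n) ι ℂ) : Submodule ℂ (Fin n → ℂ) :=
  Submodule.span ℂ {v | ∃ i < m, ∃ j, v = (A ^ i * B)ᵀ j}

/-- `U` is an orthonormal basis of the subspace `S` if `Uᴴ U = 1` and the columns of `U`
span `S`. -/
def IsOrthonormalBasisOf {n k : ℕ} (U : Matrix (Fin n) (Fin k) ℂ)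
    (S : Submodule ℂ (Fin n → ℂ)) : Prop :=
  Uᴴ * U = 1 ∧ Submodule.span ℂ (Set.range Uᵀ) = S

/-- The numerical range `W(A) = { xᴴ A x : ‖x‖₂ = 1 }` of a square complex matrix. -/
def numRange {k : ℕ} (A : Matrix (Fin k) (Fin k) ℂ) : Set ℂ :=
  {z | ∃ x : Fin k → ℂ, star x ⬝ᵥ x = 1 ∧ z = star x ⬝ᵥ A.mulVec x}

/-- The Frobenius norm of a matrix. -/
noncomputable def frobNorm {k l : ℕ} (M : Matrix (Fin k) (Fin l) ℂ) : ℝ :=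
  Real.sqrt (∑ i, ∑ j, ‖M i j‖ ^ 2)

set_option linter.unusedSectionVars false

section CauchyPart
open MeasureTheory intervalIntegral

variable {R : Type*} [NormedRing R] [NormedAlgebra ℂ R] [CompleteSpace R]

lemma hasDerivAt_inv_comp {Z : ℝ → R} {Z' : R} {x : ℝ} (hZ : HasDerivAt Z Z' x)
    (hu : IsUnit (Z x)) :
    HasDerivAt (fun y => Ring.inverse (Z y))
      (-(Ring.inverse (Z x) * Z' * Ring.inverse (Z x))) x := by
  have hR : HasFDerivAt (𝕜 := ℝ) Ring.inverse
      (-ContinuousLinearMap.mulLeftRight ℝ R ↑hu.unit⁻¹ ↑hu.unit⁻¹) (Z x) := by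
    have := hasFDerivAt_ringInverse (𝕜 := ℝ) hu.unit
    rw [hu.unit_spec] at this
    exact this
  have := hR.comp_hasDerivAt x hZ
  have h2 : (↑(hu.unit⁻¹) : R) = Ring.inverse (Z x) := by
    rw [← Ring.inverse_unit hu.unit, hu.unit_spec]
  rw [h2] at this
  simpa using! this

lemma continuousAt_inverse_of_isUnit {x : R} (hu : IsUnit x) : ContinuousAt Ring.inverse x := by
  obtain ⟨u, rfl⟩ := hu
  exact NormedRing.inverse_continuousAt u

lemma Commute.ringInverse_right' {b z : R} (h : Commute b z) : Commute b (Ring.inverse z) := by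
  by_cases hz : IsUnit z
  · obtain ⟨u, rfl⟩ := hz
    rw [Ring.inverse_unit]
    exact h.units_inv_right
  · rw [Ring.inverse_non_unit _ hz]
    exact Commute.zero_right b

set_option maxHeartbeats 1000000 in
lemma edge_homotopy (a : R) (z0 v c : ℂ)
    (hu : ∀ s ∈ Set.Icc (0:ℝ) 1, ∀ t : ℝ, IsUnit (algebraMap ℂ R (v + t * c) -
      (algebraMap ℂ R z0 + (s:ℂ) • (a - algebraMap ℂ R z0)))) :
    c • ((∫ t in (0:ℝ)..1, Ring.inverse (algebraMap ℂ R (v + t * c) - a)) -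
      ∫ t in (0:ℝ)..1, Ring.inverse (algebraMap ℂ R (v + t * c) - algebraMap ℂ R z0)) =
    ∫ s in (0:ℝ)..1, ((a - algebraMap ℂ R z0) * Ring.inverse (algebraMap ℂ R v -
        (algebraMap ℂ R z0 + (s:ℂ) • (a - algebraMap ℂ R z0)))
      - (a - algebraMap ℂ R z0) * Ring.inverse (algebraMap ℂ R (v + c) -
        (algebraMap ℂ R z0 + (s:ℂ) • (a - algebraMap ℂ R z0)))) := by
  set b := a - algebraMap ℂ R z0 with hb
  set Z : ℝ → ℝ → R := fun s t => algebraMap ℂ R (v + t * c) - (algebraMap ℂ R z0 + (s:ℂ) • b)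
    with hZ
  have hZc : Continuous (fun p : ℝ × ℝ => Z p.1 p.2) := by
    simp only [hZ, Algebra.algebraMap_eq_smul_one]
    fun_prop
  have hcontt : ∀ s ∈ Set.Icc (0:ℝ) 1, Continuous (fun t => Ring.inverse (Z s t)) := by
    intro s hs
    rw [continuous_iff_continuousAt]
    intro t
    exact (continuousAt_inverse_of_isUnit (hu s hs t)).comp (f := fun t => Z s t)
      (by fun_prop : Continuous (fun t => Z s t)).continuousAt
  have hconts : ∀ t, ContinuousOn (fun s => Ring.inverse (Z s t)) (Set.Icc 0 1) := by
    intro t s hs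
    exact ((continuousAt_inverse_of_isUnit (hu s hs t)).comp (f := fun s => Z s t)
      (by fun_prop : Continuous (fun s => Z s t)).continuousAt).continuousWithinAt
  have hZ1 : ∀ t, Z 1 t = algebraMap ℂ R (v + t * c) - a := by intro t; simp [hZ, hb]
  have hZ0 : ∀ t, Z 0 t = algebraMap ℂ R (v + t * c) - algebraMap ℂ R z0 := by
    intro t; simp [hZ]
  have hm0 : (0:ℝ) ∈ Set.Icc (0:ℝ) 1 := by simp
  have hm1 : (1:ℝ) ∈ Set.Icc (0:ℝ) 1 := by simp
  -- derivative in s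
  have hds : ∀ t : ℝ, ∫ s in (0:ℝ)..1, Ring.inverse (Z s t) * b * Ring.inverse (Z s t) =
      Ring.inverse (Z 1 t) - Ring.inverse (Z 0 t) := by
    intro t
    apply integral_eq_sub_of_hasDerivAt (f := fun s => Ring.inverse (Z s t))
    · intro s hs
      rw [Set.uIcc_of_le zero_le_one] at hs
      have h1 : HasDerivAt (fun s => Z s t) (-b) s := by
        have := ((Complex.ofRealCLM.hasDerivAt (x := s)).smul_const b).const_add
          (algebraMap ℂ R z0) |>.const_sub (algebraMap ℂ R (v + t * c))
        simpa [hZ] using! this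
      have := hasDerivAt_inv_comp h1 (hu s hs t)
      simpa using this
    · apply ContinuousOn.intervalIntegrable
      rw [Set.uIcc_of_le zero_le_one]
      exact ((hconts t).mul continuousOn_const).mul (hconts t)
  have hcomm : ∀ s t, Commute b (Z s t) := by
    intro s t
    simp only [hZ]
    refine Commute.sub_right (Algebra.commutes _ _).symm
      (Commute.add_right (Algebra.commutes _ _).symm ?_)
    exact (Commute.refl b).smul_right _
  have hcommi : ∀ s t, Commute b (Ring.inverse (Z s t)) := fun s t =>
    Commute.ringInverse_right' (hcomm s t)
  have hdt : ∀ s ∈ Set.Icc (0:ℝ) 1, ∫ t in (0:ℝ)..1,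
      c • (Ring.inverse (Z s t) * b * Ring.inverse (Z s t)) =
      b * Ring.inverse (Z s 0) - b * Ring.inverse (Z s 1) := by
    intro s hs
    have : ∫ t in (0:ℝ)..1, c • (Ring.inverse (Z s t) * b * Ring.inverse (Z s t)) =
      (-(b * Ring.inverse (Z s 1))) - (-(b * Ring.inverse (Z s 0))) := by
      apply integral_eq_sub_of_hasDerivAt (f := fun t => -(b * Ring.inverse (Z s t)))
      · intro t ht
        have h1 : HasDerivAt (fun t => Z s t) (c • 1) t := by
          have h0 : HasDerivAt (fun t : ℝ => (v + t * c)) c t := by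
            have := ((Complex.ofRealCLM.hasDerivAt (x := t)).mul_const c).const_add v
            simpa using! this
          have := (h0.smul_const (1:R)).sub_const (algebraMap ℂ R z0 + (s:ℂ) • b)
          simpa [hZ, Algebra.algebraMap_eq_smul_one] using this
        have h2 := ((hasDerivAt_inv_comp h1 (hu s hs t)).const_mul b).neg
        refine h2.congr_deriv ?_
        rw [← (hcommi s t).eq]
        simp [mul_assoc]
      · apply Continuous.intervalIntegrable
        exact (((hcontt s hs).mul continuous_const).mul (hcontt s hs)).const_smul c
    rw [this]; abel
  have hL : c • ((∫ t in (0:ℝ)..1, Ring.inverse (Z 1 t)) - ∫ t in (0:ℝ)..1, Ring.inverse (Z 0 t))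
      = ∫ t in (0:ℝ)..1, ∫ s in (0:ℝ)..1,
        c • (Ring.inverse (Z s t) * b * Ring.inverse (Z s t)) := by
    rw [← integral_sub ((hcontt 1 hm1).intervalIntegrable _ _)
      ((hcontt 0 hm0).intervalIntegrable _ _), ← intervalIntegral.integral_smul]
    congr 1
    ext t
    rw [intervalIntegral.integral_smul, hds]
  simp only [hZ1, hZ0] at hL
  have hIntg : IntegrableOn (Function.uncurry fun t s : ℝ =>
        c • (Ring.inverse (Z s t) * b * Ring.inverse (Z s t)))
        (Set.uIoc 0 1 ×ˢ Set.uIoc 0 1) := by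
    have hc : ContinuousOn (Function.uncurry fun t s : ℝ =>
        c • (Ring.inverse (Z s t) * b * Ring.inverse (Z s t))) (Set.Icc 0 1 ×ˢ Set.Icc 0 1) := by
      have h1 : ContinuousOn (fun p : ℝ × ℝ => Ring.inverse (Z p.2 p.1))
          (Set.Icc 0 1 ×ˢ Set.Icc 0 1) := by
        intro p hp
        exact ((continuousAt_inverse_of_isUnit (hu p.2 hp.2 p.1)).comp
          (f := fun p : ℝ × ℝ => Z p.2 p.1)
          (hZc.comp continuous_swap).continuousAt).continuousWithinAt
      exact ((h1.mul continuousOn_const).mul h1).const_smul c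
    have := hc.integrableOn_compact (μ := volume) (isCompact_Icc.prod isCompact_Icc)
    refine this.mono_set ?_
    rw [Set.uIoc_of_le zero_le_one]
    exact Set.prod_mono Set.Ioc_subset_Icc_self Set.Ioc_subset_Icc_self
  rw [hL, intervalIntegral_intervalIntegral_swap hIntg]
  · apply integral_congr
    intro s hs
    rw [Set.uIcc_of_le zero_le_one] at hs
    simp only
    rw [hdt s hs]
    simp [hZ]

end CauchyPart

/-- A closed convex polygon around `E`. -/
structure PolyContour (E : Set ℂ) (δ η : ℝ) where
  N : ℕ
  v : ℕ → ℂ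
  w : ℕ → ℂ
  l : ℕ → ℝ
  z0 : ℂ
  hz0 : z0 ∈ E
  hw : ∀ k, ‖w k‖ = 1
  hl : ∀ k, 0 ≤ l k
  hv : ∀ k, v (k + 1) = v k + l k * (Complex.I * w k)
  hN : v N = v 0
  hsep : ∀ k, ∀ z ∈ E, δ ≤ ((starRingEnd ℂ) (w k) * (v k - z)).re
  hnear : ∀ k, v k ∈ Metric.cthickening η E
  hwind : ∑ k ∈ Finset.range N, ∫ t in (0:ℝ)..1,
    (l k * (Complex.I * w k)) / (v k + t * (l k * (Complex.I * w k)) - z0) =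
      2 * Real.pi * Complex.I

namespace PolyContour
open MeasureTheory intervalIntegral

variable {E : Set ℂ} {δ η : ℝ} (Γ : PolyContour E δ η)

/-- edge vector -/
noncomputable def c (k : ℕ) : ℂ := Γ.l k * (Complex.I * Γ.w k)

/-- edge parametrization -/
noncomputable def s (k : ℕ) (t : ℝ) : ℂ := Γ.v k + t * Γ.c k

lemma s_continuous (k : ℕ) : Continuous (Γ.s k) := by
  unfold s; fun_prop

lemma s_sep (k : ℕ) (t : ℝ) (z : ℂ) (hz : z ∈ E) :
    δ ≤ ((starRingEnd ℂ) (Γ.w k) * (Γ.s k t - z)).re := by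
  have h := Γ.hsep k z hz
  have h1 : (starRingEnd ℂ) (Γ.w k) * Γ.w k = 1 := by
    rw [← Complex.normSq_eq_conj_mul_self, Complex.normSq_eq_norm_sq, Γ.hw k]; simp
  have : (starRingEnd ℂ) (Γ.w k) * (Γ.s k t - z) =
      (starRingEnd ℂ) (Γ.w k) * (Γ.v k - z) + (t * Γ.l k : ℝ) * Complex.I := by
    unfold s c
    push_cast
    linear_combination (t * Γ.l k * Complex.I : ℂ) * h1
  rw [this]
  simpa using h

lemma s_mem (hE : Convex ℝ E) (k : ℕ) (t : ℝ) (ht : t ∈ Set.Icc (0:ℝ) 1) :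
    Γ.s k t ∈ Metric.cthickening η E := by
  have hc := hE.cthickening η
  have h := hc (Γ.hnear k) (Γ.hnear (k+1)) (sub_nonneg.2 ht.2) ht.1 (by ring)
  convert h using 1
  rw [Γ.hv]
  unfold s c
  simp only [Complex.real_smul]
  push_cast
  ring

variable {R : Type*} [NormedRing R] [NormedAlgebra ℂ R] [CompleteSpace R]

/-- the unit hypothesis -/
def Good (a : R) : Prop := ∀ k, ∀ r ∈ Set.Icc (0:ℝ) 1, ∀ t : ℝ,
  IsUnit (algebraMap ℂ R (Γ.s k t) -
      (algebraMap ℂ R Γ.z0 + (r:ℂ) • (a - algebraMap ℂ R Γ.z0)))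

variable {Γ}
lemma Good.unit {a : R} (h : Γ.Good a) (k : ℕ) (t : ℝ) :
    IsUnit (algebraMap ℂ R (Γ.s k t) - a) := by
  have := h k 1 (by simp) t
  simpa using this

lemma cont_res {a : R} (k : ℕ) (h : ∀ t, IsUnit (algebraMap ℂ R (Γ.s k t) - a)) :
    Continuous (fun t => Ring.inverse (algebraMap ℂ R (Γ.s k t) - a)) := by
  have hc : Continuous fun t => algebraMap ℂ R (Γ.s k t) - a := by
    have := Γ.s_continuous k
    simp only [Algebra.algebraMap_eq_smul_one]
    fun_prop
  rw [continuous_iff_continuousAt]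
  intro t
  exact (continuousAt_inverse_of_isUnit (h t)).comp
    (f := fun t => algebraMap ℂ R (Γ.s k t) - a) hc.continuousAt

lemma inverse_algebraMap' {x : ℂ} (hx : x ≠ 0) :
    Ring.inverse (algebraMap ℂ R x) = x⁻¹ • (1:R) := by
  have hu : IsUnit (algebraMap ℂ R x) := (IsUnit.mk0 x hx).map _
  rw [← mul_one (Ring.inverse _), Ring.inverse_mul_eq_iff_eq_mul _ _ _ hu,
    Algebra.algebraMap_eq_smul_one, smul_mul_smul_comm, mul_inv_cancel₀ hx]
  simp

lemma cauchy_one (hδ : 0 < δ) {a : R} (h : Γ.Good a) :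
    ∑ k ∈ Finset.range Γ.N, Γ.c k • ∫ t in (0:ℝ)..1, Ring.inverse (algebraMap ℂ R (Γ.s k t) - a) =
      (2 * Real.pi * Complex.I) • (1 : R) := by
  set Y : ℕ → ℝ → R := fun k r => (a - algebraMap ℂ R Γ.z0) *
    Ring.inverse (algebraMap ℂ R (Γ.v k) -
        (algebraMap ℂ R Γ.z0 + (r:ℂ) • (a - algebraMap ℂ R Γ.z0))) with hY
  have hYi : ∀ k, IntervalIntegrable (Y k) volume 0 1 := by
    intro k
    apply ContinuousOn.intervalIntegrable
    rw [Set.uIcc_of_le zero_le_one]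
    refine continuousOn_const.mul ?_
    intro r hr
    have hu := h k r hr 0
    simp only [s, Complex.ofReal_zero, zero_mul, add_zero] at hu
    exact ((continuousAt_inverse_of_isUnit hu).comp
      (f := fun r : ℝ => (algebraMap ℂ R (Γ.v k) -
        (algebraMap ℂ R Γ.z0 + (r:ℂ) • (a - algebraMap ℂ R Γ.z0))))
        (by fun_prop)).continuousWithinAt
  have hedge : ∀ k, Γ.c k • ((∫ t in (0:ℝ)..1, Ring.inverse (algebraMap ℂ R (Γ.s k t) - a)) -
      ∫ t in (0:ℝ)..1, Ring.inverse (algebraMap ℂ R (Γ.s k t) - algebraMap ℂ R Γ.z0)) =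
      (∫ r in (0:ℝ)..1, Y k r) - ∫ r in (0:ℝ)..1, Y (k+1) r := by
    intro k
    rw [← integral_sub (hYi k) (hYi (k+1))]
    have := edge_homotopy a Γ.z0 (Γ.v k) (Γ.c k) (h k)
    simp only [hY, Γ.hv k]
    exact this
  have hsum : ∑ k ∈ Finset.range Γ.N, Γ.c k • ((∫ t in (0:ℝ)..1, Ring.inverse (algebraMap ℂ R (Γ.s k t) - a)) -
      ∫ t in (0:ℝ)..1, Ring.inverse (algebraMap ℂ R (Γ.s k t) - algebraMap ℂ R Γ.z0)) = 0 := by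
    rw [Finset.sum_congr rfl (fun k _ => hedge k), Finset.sum_range_sub']
    simp only [hY, Γ.hN, sub_self]
  simp only [smul_sub, Finset.sum_sub_distrib] at hsum
  rw [sub_eq_zero] at hsum
  rw [hsum, ← Γ.hwind, Finset.sum_smul]
  refine Finset.sum_congr rfl fun k _ => ?_
  rw [← intervalIntegral.integral_smul, ← intervalIntegral.integral_smul_const]
  refine integral_congr fun t _ => ?_
  have hne : Γ.s k t - Γ.z0 ≠ 0 := by
    intro h0
    have := Γ.s_sep k t Γ.z0 Γ.hz0
    rw [h0] at this
    simp at this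
    linarith
  rw [← map_sub, inverse_algebraMap' hne, smul_smul, div_eq_mul_inv]
  rfl

lemma integral_pow (k j : ℕ) : ∫ t in (0:ℝ)..1, Γ.c k * Γ.s k t ^ j =
    (Γ.v (k+1)) ^ (j+1) / (j+1) - (Γ.v k) ^ (j+1) / (j+1) := by
  have := integral_eq_sub_of_hasDerivAt (a := 0) (b := 1) (f := fun t : ℝ => (Γ.s k t) ^ (j+1) / ((j:ℂ)+1))
    (f' := fun t => Γ.c k * Γ.s k t ^ j) ?_ ?_
  · rw [this, Γ.hv]; simp [s, c]
  · intro t _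
    have h0 : HasDerivAt (Γ.s k) (Γ.c k) t := by
      have := ((Complex.ofRealCLM.hasDerivAt (x := t)).mul_const (Γ.c k)).const_add (Γ.v k)
      simp only [Complex.ofRealCLM_apply, Complex.ofReal_one, one_mul] at this
      exact this
    have := (h0.pow (j+1)).div_const ((j:ℂ)+1)
    refine this.congr_deriv ?_
    have : (j:ℂ) + 1 ≠ 0 := by exact_mod_cast Nat.succ_ne_zero j
    push_cast
    field_simp
  · apply Continuous.intervalIntegrable
    have := Γ.s_continuous k
    fun_prop

lemma sum_integral_pow (j : ℕ) :
    ∑ k ∈ Finset.range Γ.N, ∫ t in (0:ℝ)..1, Γ.c k * Γ.s k t ^ j = 0 := by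
  simp only [integral_pow]
  rw [Finset.sum_range_sub (fun k => (Γ.v k) ^ (j+1) / ((j:ℂ)+1)), Γ.hN, sub_self]

lemma cauchy (hδ : 0 < δ) {a : R} (h : Γ.Good a) (f : Polynomial ℂ) :
    ∑ k ∈ Finset.range Γ.N, ∫ t in (0:ℝ)..1, (Γ.c k * f.eval (Γ.s k t)) •
      Ring.inverse (algebraMap ℂ R (Γ.s k t) - a) =
      (2 * Real.pi * Complex.I) • aeval a f := by
  have hci : ∀ (f : Polynomial ℂ) k, IntervalIntegrable (fun t => (Γ.c k * f.eval (Γ.s k t)) •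
      Ring.inverse (algebraMap ℂ R (Γ.s k t) - a)) volume 0 1 := by
    intro f k
    apply Continuous.intervalIntegrable
    have := Γ.s_continuous k
    have h2 := cont_res k (h.unit k)
    have h3 : Continuous fun t => f.eval (Γ.s k t) := f.continuous.comp this
    fun_prop
  induction f using Polynomial.induction_on' with
  | add p q hp hq =>
    simp only [eval_add, mul_add, add_smul, map_add, smul_add]
    rw [← hp, ← hq, ← Finset.sum_add_distrib]
    refine Finset.sum_congr rfl fun k _ => ?_
    rw [← integral_add (hci p k) (hci q k)]
  | monomial j b =>
    induction j with
    | zero =>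
      have := cauchy_one hδ h
      simp only [monomial_zero_left, eval_C, aeval_C]
      rw [Algebra.algebraMap_eq_smul_one, smul_comm, ← this, Finset.smul_sum]
      refine Finset.sum_congr rfl fun k _ => ?_
      rw [← intervalIntegral.integral_smul, ← intervalIntegral.integral_smul]
      simp only [smul_smul, mul_comm]
    | succ j ih =>
      have key : ∀ k t, (Γ.c k * (monomial (j+1) b).eval (Γ.s k t)) •
        Ring.inverse (algebraMap ℂ R (Γ.s k t) - a) = (Γ.c k * Γ.s k t ^ j) • (b • (1:R)) +
          a * ((Γ.c k * (monomial j b).eval (Γ.s k t)) •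
            Ring.inverse (algebraMap ℂ R (Γ.s k t) - a)) := by
        intro k t
        have h1 : (algebraMap ℂ R (Γ.s k t) - a) * Ring.inverse (algebraMap ℂ R (Γ.s k t) - a) = 1 :=
          Ring.mul_inverse_cancel _ (h.unit k t)
        rw [sub_mul, Algebra.algebraMap_eq_smul_one, smul_mul_assoc, one_mul, sub_eq_iff_eq_add,
          ← Algebra.algebraMap_eq_smul_one] at h1
        simp only [eval_monomial]
        have h2 : Γ.c k * (b * Γ.s k t ^ (j+1)) = (Γ.c k * (b * Γ.s k t ^ j)) * Γ.s k t := by ring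
        rw [h2, mul_smul, h1, smul_add, mul_smul_comm, smul_smul]
        congr 2
        ring
      simp only [key]
      have hadd : ∀ k, ∫ t in (0:ℝ)..1, ((Γ.c k * Γ.s k t ^ j) • (b • (1:R)) +
          a * ((Γ.c k * (monomial j b).eval (Γ.s k t)) •
            Ring.inverse (algebraMap ℂ R (Γ.s k t) - a))) =
          (∫ t in (0:ℝ)..1, (Γ.c k * Γ.s k t ^ j)) • (b • (1:R)) +
          a * ∫ t in (0:ℝ)..1, ((Γ.c k * (monomial j b).eval (Γ.s k t)) •
            Ring.inverse (algebraMap ℂ R (Γ.s k t) - a)) := by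
        intro k
        rw [intervalIntegral.integral_add, intervalIntegral.integral_smul_const]
        · congr 1
          exact (ContinuousLinearMap.mul ℂ R a).intervalIntegral_comp_comm (hci (monomial j b) k)
        · apply Continuous.intervalIntegrable
          have := Γ.s_continuous k
          fun_prop
        · exact (hci (monomial j b) k).const_mul a
      rw [Finset.sum_congr rfl (fun k _ => hadd k), Finset.sum_add_distrib, ← Finset.sum_smul,
        sum_integral_pow, zero_smul, zero_add, ← Finset.mul_sum, ih, mul_smul_comm]
      congr 1
      rw [aeval_monomial, aeval_monomial, ← mul_assoc, ← Algebra.commutes, mul_assoc, pow_succ']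
end PolyContour

section HilbertPart
open MeasureTheory intervalIntegral

lemma neumann_mem {R : Type*} [NormedRing R] [NormedAlgebra ℂ R] [CompleteSpace R] (m : R) (τ : ℝ)
    (hτ : 0 < τ) (h : ‖(τ:ℂ) • (1:R) - m‖ < τ) :
    IsUnit m ∧ ∀ T : Subalgebra ℂ R, IsClosed (T : Set R) → m ∈ T → Ring.inverse m ∈ T := by
  have hτ' : (τ:ℂ) ≠ 0 := by exact_mod_cast hτ.ne'
  set x : R := (τ:ℂ)⁻¹ • ((τ:ℂ) • (1:R) - m) with hx
  have hxn : ‖x‖ < 1 := by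
    rw [hx, norm_smul, norm_inv, Complex.norm_real, Real.norm_of_nonneg hτ.le]
    rw [inv_mul_lt_iff₀ hτ]; simpa using h
  have hm : m = (τ:ℂ) • (1 - x) := by
    rw [hx, smul_sub, smul_smul, mul_inv_cancel₀ hτ', one_smul]
    abel
  have hu1 : IsUnit (1 - x) := isUnit_one_sub_of_norm_lt_one hxn
  have hu : IsUnit m := by
    rw [hm, ← one_mul (1 - x), ← smul_mul_assoc, ← Algebra.algebraMap_eq_smul_one]
    exact ((IsUnit.mk0 _ hτ').map _).mul hu1
  refine ⟨hu, fun T hT hmT => ?_⟩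
  have hinv : Ring.inverse m = (τ:ℂ)⁻¹ • Ring.inverse (1 - x) := by
    rw [← mul_one (Ring.inverse m), Ring.inverse_mul_eq_iff_eq_mul _ _ _ hu]
    nth_rewrite 1 [hm]
    rw [smul_mul_smul_comm, mul_inv_cancel₀ hτ', one_smul, Ring.mul_inverse_cancel _ hu1]
  rw [hinv]
  refine T.smul_mem ?_ _
  rw [NormedRing.inverse_one_sub x hxn]
  have hxT : x ∈ T := T.smul_mem (T.sub_mem (T.smul_mem T.one_mem _) hmT) _
  have : (↑(Units.oneSub x hxn)⁻¹ : R) = ∑' n, x ^ n := rfl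
  rw [this]
  have hs := (summable_geometric_of_norm_lt_one hxn).hasSum
  exact hT.mem_of_tendsto hs (Filter.Eventually.of_forall fun s =>
    T.sum_mem fun i _ => T.pow_mem hxT i)

variable {H : Type*} [NormedAddCommGroup H] [InnerProductSpace ℂ H] [CompleteSpace H]

lemma near_tau (M : H →L[ℂ] H) (δ τ : ℝ) (hτ : 0 < τ)
    (hM : ∀ x, δ * ‖x‖ ^ 2 ≤ (inner ℂ x (M x)).re) (h : ‖M‖ ^ 2 < 2 * τ * δ) :
    ‖(τ:ℂ) • (1 : H →L[ℂ] H) - M‖ < τ := by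
  have h0 : ‖(τ:ℂ) • (1 : H →L[ℂ] H) - M‖ ≤ Real.sqrt (max 0 (τ ^ 2 - 2 * τ * δ + ‖M‖ ^ 2)) := by
    apply ContinuousLinearMap.opNorm_le_bound _ (Real.sqrt_nonneg _)
    intro x
    apply le_of_sq_le_sq _ (by positivity)
    rw [mul_pow, Real.sq_sqrt (le_max_left _ _)]
    have e : ((τ:ℂ) • (1 : H →L[ℂ] H) - M) x = (τ:ℂ) • x - M x := by simp
    rw [e, @norm_sub_sq ℂ]
    have h1 := hM x
    have h2 : ‖M x‖ ^ 2 ≤ ‖M‖ ^ 2 * ‖x‖ ^ 2 := by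
      rw [← mul_pow]; gcongr; exact M.le_opNorm x
    have h3 : RCLike.re (inner ℂ ((τ:ℂ) • x) (M x)) = τ * (inner ℂ x (M x)).re := by
      rw [inner_smul_left]; simp
    rw [h3, norm_smul, Complex.norm_real, Real.norm_of_nonneg hτ.le]
    have h4 : (τ ^ 2 - 2 * τ * δ + ‖M‖ ^ 2) * ‖x‖ ^ 2 ≤
        max 0 (τ ^ 2 - 2 * τ * δ + ‖M‖ ^ 2) * ‖x‖ ^ 2 := by
      gcongr; exact le_max_right _ _
    nlinarith
  refine h0.trans_lt ?_
  rw [Real.sqrt_lt' hτ]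
  apply max_lt (by positivity)
  linarith

/-- numerical range of operator contained in E -/
def WIn (S : H →L[ℂ] H) (E : Set ℂ) : Prop :=
  ∀ x : H, ∃ ξ ∈ E, inner ℂ x (S x) = (‖x‖ ^ 2 : ℝ) * ξ

variable {E : Set ℂ} {δ η : ℝ}

lemma WIn.homotopy {S : H →L[ℂ] H} (hS : WIn S E) (hE : Convex ℝ E) {z0 : ℂ} (hz : z0 ∈ E)
    {r : ℝ} (hr : r ∈ Set.Icc (0:ℝ) 1) :
    WIn (algebraMap ℂ (H →L[ℂ] H) z0 + (r:ℂ) • (S - algebraMap ℂ (H →L[ℂ] H) z0)) E := by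
  intro x
  obtain ⟨ξ, hξ, h⟩ := hS x
  refine ⟨_, hE hz hξ (sub_nonneg.2 hr.2) hr.1 (by ring), ?_⟩
  have e : (algebraMap ℂ (H →L[ℂ] H) z0 + (r:ℂ) • (S - algebraMap ℂ (H →L[ℂ] H) z0)) x =
      z0 • x + (r:ℂ) • (S x - z0 • x) := by
    simp [Algebra.algebraMap_eq_smul_one]
  rw [e, inner_add_right, inner_smul_right, inner_smul_right, inner_sub_right, inner_smul_right, h,
    inner_self_eq_norm_sq_to_K]
  simp only [Complex.real_smul]
  push_cast
  simp only [Complex.coe_algebraMap]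
  ring

lemma WIn.coercive {S : H →L[ℂ] H} (hS : WIn S E) (Γ : PolyContour E δ η) (k : ℕ) (t : ℝ) (x : H) :
    δ * ‖x‖ ^ 2 ≤ (inner ℂ x (((starRingEnd ℂ) (Γ.w k) •
      (algebraMap ℂ (H →L[ℂ] H) (Γ.s k t) - S)) x)).re := by
  obtain ⟨ξ, hξ, h⟩ := hS x
  have h1 := Γ.s_sep k t ξ hξ
  have e : inner ℂ x (((starRingEnd ℂ) (Γ.w k) •
      (algebraMap ℂ (H →L[ℂ] H) (Γ.s k t) - S)) x) =
      ((‖x‖ ^ 2 : ℝ) : ℂ) * ((starRingEnd ℂ) (Γ.w k) * (Γ.s k t - ξ)) := by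
    have e : ((starRingEnd ℂ) (Γ.w k) • (algebraMap ℂ (H →L[ℂ] H) (Γ.s k t) - S)) x =
      (starRingEnd ℂ) (Γ.w k) • (Γ.s k t • x - S x) := by
      simp [Algebra.algebraMap_eq_smul_one]
    rw [e, inner_smul_right, inner_sub_right, inner_smul_right, h, inner_self_eq_norm_sq_to_K]
    push_cast
    simp only [Complex.coe_algebraMap]
    ring
  rw [e, Complex.re_ofReal_mul]
  nlinarith [sq_nonneg ‖x‖]

lemma isUnit_of_smul {R : Type*} [Ring R] [Algebra ℂ R] {w : ℂ} {m : R} (hw : w ≠ 0)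
    (h : IsUnit (w • m)) :
    IsUnit m := by
  have : m = algebraMap ℂ R w⁻¹ * (w • m) := by
    rw [Algebra.algebraMap_eq_smul_one, smul_mul_assoc, one_mul, smul_smul, inv_mul_cancel₀ hw,
      one_smul]
  rw [this]
  exact ((IsUnit.mk0 _ (inv_ne_zero hw)).map _).mul h

lemma PolyContour.w_ne (Γ : PolyContour E δ η) (k : ℕ) : (starRingEnd ℂ) (Γ.w k) ≠ 0 := by
  intro h
  have := Γ.hw k
  rw [map_eq_zero] at h
  rw [h] at this
  simp at this

lemma WIn.isUnit {S : H →L[ℂ] H} (hS : WIn S E) (hδ : 0 < δ) (Γ : PolyContour E δ η) (k : ℕ)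
    (t : ℝ) : IsUnit (algebraMap ℂ (H →L[ℂ] H) (Γ.s k t) - S) := by
  set M := (starRingEnd ℂ) (Γ.w k) • (algebraMap ℂ (H →L[ℂ] H) (Γ.s k t) - S) with hM
  refine isUnit_of_smul (Γ.w_ne k) (m := (algebraMap ℂ (H →L[ℂ] H) (Γ.s k t) - S)) ?_
  have hτ : 0 < (‖M‖ ^ 2 + 1) / δ := by positivity
  refine (neumann_mem M _ hτ (near_tau M δ _ hτ (fun x => hS.coercive Γ k t x) ?_)).1
  rw [mul_assoc, div_mul_cancel₀ _ hδ.ne']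
  nlinarith [sq_nonneg ‖M‖]

lemma WIn.good {S : H →L[ℂ] H} (hS : WIn S E) (hE : Convex ℝ E) (hδ : 0 < δ)
    (Γ : PolyContour E δ η) : Γ.Good S := by
  intro k r hr t
  exact (hS.homotopy hE Γ.hz0 hr).isUnit hδ Γ k t

/-- Cauchy transform of the conjugate of `f`, evaluated at `a`. -/
noncomputable def PolyContour.tr (Γ : PolyContour E δ η) {R : Type*} [NormedRing R]
    [NormedAlgebra ℂ R] [CompleteSpace R] (f : Polynomial ℂ) (a : R) : R :=
  (2 * Real.pi * Complex.I)⁻¹ • ∑ k ∈ Finset.range Γ.N, ∫ t in (0:ℝ)..1,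
    (Γ.c k * (starRingEnd ℂ) (f.eval (Γ.s k t))) • Ring.inverse (algebraMap ℂ R (Γ.s k t) - a)

/-- The positive kernel. -/
noncomputable def PolyContour.P (Γ : PolyContour E δ η) (S : H →L[ℂ] H) (k : ℕ) (t : ℝ) :
    H →L[ℂ] H :=
  Γ.w k • Ring.inverse (algebraMap ℂ (H →L[ℂ] H) (Γ.s k t) - S) +
    star (Γ.w k • Ring.inverse (algebraMap ℂ (H →L[ℂ] H) (Γ.s k t) - S))

lemma P_cont {S : H →L[ℂ] H} (hS : WIn S E) (hδ : 0 < δ)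
    (Γ : PolyContour E δ η) (k : ℕ) : Continuous (Γ.P S k) := by
  have h := PolyContour.cont_res (Γ := Γ) (a := S) k (hS.isUnit hδ Γ k)
  unfold PolyContour.P
  fun_prop

lemma rep {S : H →L[ℂ] H} (hS : WIn S E) (hE : Convex ℝ E) (hδ : 0 < δ)
    (Γ : PolyContour E δ η) (f : Polynomial ℂ) :
    aeval S f + star (Γ.tr f S) = ∑ k ∈ Finset.range Γ.N, ((Γ.l k / (2 * Real.pi) : ℝ) : ℂ) •
      ∫ t in (0:ℝ)..1, f.eval (Γ.s k t) • Γ.P S k t := by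
  have hpi : (2 * Real.pi * Complex.I : ℂ) ≠ 0 := by simp [Real.pi_ne_zero]
  have hpi2 : (Real.pi : ℂ) ≠ 0 := by simp [Real.pi_ne_zero]
  have h1 : aeval S f = (2 * Real.pi * Complex.I : ℂ)⁻¹ • ∑ k ∈ Finset.range Γ.N,
      ∫ t in (0:ℝ)..1, (Γ.c k * f.eval (Γ.s k t)) •
      Ring.inverse (algebraMap ℂ (H →L[ℂ] H) (Γ.s k t) - S) := by
    rw [PolyContour.cauchy hδ (hS.good hE hδ Γ) f, smul_smul, inv_mul_cancel₀ hpi, one_smul]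
  have hc := fun k => PolyContour.cont_res (Γ := Γ) (a := S) k (hS.isUnit hδ Γ k)
  have hf : ∀ k, Continuous fun t => f.eval (Γ.s k t) :=
    fun k => f.continuous.comp (Γ.s_continuous k)
  have hstar : ∀ F : ℝ → (H →L[ℂ] H), Continuous F →
      star (∫ t in (0:ℝ)..1, F t) = ∫ t in (0:ℝ)..1, star (F t) := by
    intro F hF
    have := ((starL' ℝ : (H →L[ℂ] H) ≃L[ℝ] (H →L[ℂ] H)) :
      (H →L[ℂ] H) →L[ℝ] (H →L[ℂ] H)).intervalIntegral_comp_comm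
      (hF.intervalIntegrable (μ := volume) 0 1)
    simpa using this.symm
  rw [h1, PolyContour.tr, star_smul, star_sum, Finset.smul_sum, Finset.smul_sum,
    ← Finset.sum_add_distrib]
  refine Finset.sum_congr rfl fun k _ => ?_
  rw [hstar _ (by have := hf k; have := hc k; fun_prop), ← intervalIntegral.integral_smul, ← intervalIntegral.integral_smul,
    ← intervalIntegral.integral_smul, ← intervalIntegral.integral_add]
  · refine integral_congr fun t _ => ?_
    simp only [PolyContour.P, smul_add, star_smul, smul_smul]
    congr 2
    · rw [PolyContour.c]; push_cast; field_simp
    · rw [PolyContour.c]; simp; field_simp; rw [Complex.I_sq]; ring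
  · apply Continuous.intervalIntegrable
    have := hf k; have := hc k; fun_prop
  · apply Continuous.intervalIntegrable
    have := hf k; have := hc k; fun_prop

lemma P_pos {S : H →L[ℂ] H} (hS : WIn S E) (hδ : 0 < δ)
    (Γ : PolyContour E δ η) (k : ℕ) (t : ℝ) (x : H) : 0 ≤ (inner ℂ x (Γ.P S k t x)).re := by
  set I := Ring.inverse (algebraMap ℂ (H →L[ℂ] H) (Γ.s k t) - S) with hI
  have hu := hS.isUnit hδ Γ k t
  have e : inner ℂ x (Γ.P S k t x) = inner ℂ x ((Γ.w k • I) x) + inner ℂ ((Γ.w k • I) x) x := by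
    rw [PolyContour.P, ← hI, ContinuousLinearMap.add_apply, inner_add_right,
      ContinuousLinearMap.star_eq_adjoint, ContinuousLinearMap.adjoint_inner_right]
  have hc := hS.coercive Γ k t (I x)
  have hxx : (algebraMap ℂ (H →L[ℂ] H) (Γ.s k t) - S) (I x) = x := by
    rw [← ContinuousLinearMap.mul_apply, hI, Ring.mul_inverse_cancel _ hu]; rfl
  rw [ContinuousLinearMap.smul_apply, hxx] at hc
  have h1 : (inner ℂ ((Γ.w k • I) x) x).re = (inner ℂ x ((Γ.w k • I) x)).re := by
    rw [← inner_conj_symm, Complex.conj_re]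
  rw [e, Complex.add_re, ← h1, ContinuousLinearMap.smul_apply, inner_smul_left]
  rw [inner_smul_right] at hc
  have : 0 ≤ δ * ‖I x‖ ^ 2 := by positivity
  linarith

lemma P_symm {S : H →L[ℂ] H} (Γ : PolyContour E δ η) (k : ℕ) (t : ℝ) (x y : H) :
    inner ℂ x (Γ.P S k t y) = (starRingEnd ℂ) (inner ℂ y (Γ.P S k t x)) := by
  have hsa : star (Γ.P S k t) = Γ.P S k t := by
    simp [PolyContour.P, add_comm]
  rw [inner_conj_symm, ← ContinuousLinearMap.adjoint_inner_left,
    ← ContinuousLinearMap.star_eq_adjoint, hsa]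

lemma P_cs {S : H →L[ℂ] H} (hS : WIn S E) (hδ : 0 < δ)
    (Γ : PolyContour E δ η) (k : ℕ) (t : ℝ) (x y : H) :
    ‖inner ℂ y (Γ.P S k t x)‖ ≤
      ((inner ℂ x (Γ.P S k t x)).re + (inner ℂ y (Γ.P S k t y)).re) / 2 := by
  obtain ⟨e, he, hb⟩ : ∃ e : ℂ, ‖e‖ = 1 ∧ (‖inner ℂ y (Γ.P S k t x)‖ : ℂ) =
      e * inner ℂ y (Γ.P S k t x) := by
    obtain ⟨c, hc, h⟩ := RCLike.exists_norm_eq_mul_self (inner ℂ y (Γ.P S k t x))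
    exact ⟨c, hc, h⟩
  have h := P_pos hS hδ Γ k t (e • x - y)
  have hee : (starRingEnd ℂ) e * e = 1 := by
    rw [← Complex.normSq_eq_conj_mul_self, Complex.normSq_eq_norm_sq, he]; simp
  rw [map_sub, map_smul, inner_sub_right, inner_sub_left, inner_sub_left, inner_smul_right,
    inner_smul_right, inner_smul_left, inner_smul_left, P_symm Γ k t x y, ← map_mul, ← hb,
    ← mul_assoc, mul_comm e, hee, one_mul] at h
  simp at h
  linarith

set_option maxHeartbeats 1000000 in
lemma norm_rep_le {S : H →L[ℂ] H} (hS : WIn S E) (hE : Convex ℝ E) (hδ : 0 < δ)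
    (Γ : PolyContour E δ η) (f : Polynomial ℂ) (M : ℝ)
    (hM : ∀ z ∈ Metric.cthickening η E, ‖f.eval z‖ ≤ M) :
    ‖aeval S f + star (Γ.tr f S)‖ ≤ 2 * M := by
  have hM0 : 0 ≤ M := (norm_nonneg _).trans (hM _ (Γ.hnear 0))
  have hPc := fun k => P_cont hS hδ Γ k
  -- evaluate inner products
  have ev : ∀ (g : Polynomial ℂ) (x y : H), (inner ℂ y ((aeval S g + star (Γ.tr g S)) x)).re =
      ∑ k ∈ Finset.range Γ.N, (Γ.l k / (2 * Real.pi)) *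
        ∫ t in (0:ℝ)..1, (g.eval (Γ.s k t) * inner ℂ y (Γ.P S k t x)).re := by
    intro g x y
    have hg : ∀ k, Continuous fun t => g.eval (Γ.s k t) :=
      fun k => g.continuous.comp (Γ.s_continuous k)
    rw [rep hS hE hδ Γ g, ContinuousLinearMap.sum_apply, inner_sum, Complex.re_sum]
    refine Finset.sum_congr rfl fun k _ => ?_
    rw [ContinuousLinearMap.smul_apply, inner_smul_right, Complex.re_ofReal_mul]
    congr 1
    set L : (H →L[ℂ] H) →L[ℂ] ℂ := (innerSL ℂ y).comp (ContinuousLinearMap.apply ℂ H x) with hL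
    have hi : IntervalIntegrable (fun t => g.eval (Γ.s k t) • Γ.P S k t) volume 0 1 := by
      apply Continuous.intervalIntegrable
      have := hg k; have := hPc k; fun_prop
    have h1 := L.intervalIntegral_comp_comm hi
    have hi2 : IntervalIntegrable (fun t => L (g.eval (Γ.s k t) • Γ.P S k t)) volume 0 1 := by
      apply Continuous.intervalIntegrable
      have := hg k; have := hPc k; fun_prop
    have h2 := Complex.reCLM.intervalIntegral_comp_comm hi2
    rw [h1] at h2
    have e : ∀ B, L B = inner ℂ y (B x) := fun B => rfl
    simp only [e, Complex.reCLM_apply, ContinuousLinearMap.smul_apply, inner_smul_right] at h2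
    exact h2.symm
  have htr1 : ∀ x, (inner ℂ x ((aeval S (1 : Polynomial ℂ) + star (Γ.tr 1 S)) x)).re
      = 2 * ‖x‖ ^ 2 := by
    intro x
    have hpi : (2 * Real.pi * Complex.I : ℂ) ≠ 0 := by simp [Real.pi_ne_zero]
    have : Γ.tr 1 S = 1 := by
      have h := PolyContour.cauchy hδ (hS.good hE hδ Γ) 1
      simp only [PolyContour.tr, eval_one, map_one] at h ⊢
      rw [h, smul_smul, inv_mul_cancel₀ hpi, one_smul]
    rw [this]
    simp only [map_one, star_one, ContinuousLinearMap.add_apply, ContinuousLinearMap.one_apply,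
      inner_add_right, Complex.add_re]
    have := inner_self_eq_norm_sq (𝕜 := ℂ) x
    simp only [RCLike.re_to_complex] at this
    rw [this]; ring
  have hcP : ∀ k (x y : H), Continuous fun t => inner ℂ y (Γ.P S k t x) := by
    intro k x y
    exact (innerSL ℂ y).continuous.comp
      ((ContinuousLinearMap.apply ℂ H x).continuous.comp (hPc k))
  have key : ∀ x y : H, (inner ℂ y ((aeval S f + star (Γ.tr f S)) x)).re ≤
      M * (‖x‖ ^ 2 + ‖y‖ ^ 2) := by
    intro x y
    have hx := htr1 x
    have hy := htr1 y
    rw [ev] at hx hy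
    rw [ev]
    have : M * (‖x‖ ^ 2 + ‖y‖ ^ 2) = ∑ k ∈ Finset.range Γ.N, (Γ.l k / (2 * Real.pi)) *
        (∫ t in (0:ℝ)..1, M / 2 * ((inner ℂ x (Γ.P S k t x)).re +
          (inner ℂ y (Γ.P S k t y)).re)) := by
      have e : M * (‖x‖ ^ 2 + ‖y‖ ^ 2) = M / 2 * (2 * ‖x‖ ^ 2 + 2 * ‖y‖ ^ 2) := by ring
      rw [e, ← hx, ← hy, ← Finset.sum_add_distrib, Finset.mul_sum]
      refine Finset.sum_congr rfl fun k _ => ?_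
      rw [intervalIntegral.integral_const_mul, intervalIntegral.integral_add]
      · simp only [eval_one, one_mul]; ring
      · exact (Complex.continuous_re.comp (hcP k x x)).intervalIntegrable _ _
      · exact (Complex.continuous_re.comp (hcP k y y)).intervalIntegrable _ _
    rw [this]
    refine Finset.sum_le_sum fun k _ => ?_
    have hl := Γ.hl k
    have hpi := Real.pi_pos
    refine mul_le_mul_of_nonneg_left ?_ (by positivity)
    apply integral_mono_on zero_le_one
    · apply Continuous.intervalIntegrable
      have h1 : Continuous fun t => f.eval (Γ.s k t) := f.continuous.comp (Γ.s_continuous k)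
      exact Complex.continuous_re.comp (h1.mul (hcP k x y))
    · apply Continuous.intervalIntegrable
      exact continuous_const.mul ((Complex.continuous_re.comp (hcP k x x)).add
        (Complex.continuous_re.comp (hcP k y y)))
    · intro t ht
      refine (Complex.re_le_norm _).trans ?_
      rw [norm_mul]
      have h1 := hM _ (Γ.s_mem hE k t ht)
      have h2 := P_cs hS hδ Γ k t x y
      calc _ ≤ M * (((inner ℂ x (Γ.P S k t x)).re + (inner ℂ y (Γ.P S k t y)).re) / 2) := by
            gcongr
        _ = _ := by ring
  apply ContinuousLinearMap.opNorm_le_bound _ (by positivity)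
  intro x
  set Q := aeval S f + star (Γ.tr f S)
  by_cases hq : ‖Q x‖ = 0
  · rw [hq]; positivity
  by_cases hx : ‖x‖ = 0
  · rw [norm_eq_zero] at hx; simp [hx]
  have h := key x (((‖x‖ / ‖Q x‖ : ℝ) : ℂ) • Q x)
  rw [inner_smul_left, norm_smul, Complex.conj_ofReal, Complex.re_ofReal_mul] at h
  have hs := inner_self_eq_norm_sq (𝕜 := ℂ) (Q x)
  simp only [RCLike.re_to_complex] at hs
  rw [hs, Complex.norm_real, Real.norm_of_nonneg (by positivity), div_mul_cancel₀ _ hq] at h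
  have e : ‖x‖ / ‖Q x‖ * ‖Q x‖ ^ 2 = ‖x‖ * ‖Q x‖ := by field_simp
  rw [e] at h
  have hxp : 0 < ‖x‖ := lt_of_le_of_ne (norm_nonneg _) (Ne.symm hx)
  nlinarith

end HilbertPart

section ContourExists
open MeasureTheory intervalIntegral

lemma near_vertex {E : Set ℂ} (hE : Convex ℝ E) {D δ β η : ℝ} (hδ : 0 < δ) (hβ : 0 < β)
    (hβ2 : β < Real.pi / 2)
    (hD : ∀ x ∈ E, ∀ y ∈ E, ‖x - y‖ ≤ D) (hη : δ + (D + δ) * β ≤ η)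
    (u v z z' : ℂ) (h h' y x : ℝ) (hu : ‖u‖ = 1) (hz : z ∈ E) (hz' : z' ∈ E)
    (hh : h = ((starRingEnd ℂ) u * z).re + δ)
    (hh' : h' = ((starRingEnd ℂ) (u * Complex.exp (β * Complex.I)) * z').re + δ)
    (hle : ((starRingEnd ℂ) u * z').re + δ ≤ h)
    (hle' : ((starRingEnd ℂ) (u * Complex.exp (β * Complex.I)) * z).re + δ ≤ h')
    (hv : v = u * (h + Complex.I * y))
    (hv' : v = u * Complex.exp (β * Complex.I) * (h' + Complex.I * x))
    (hy : y = (h' - h * Real.cos β) / Real.sin β)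
    (hx : x = (h' * Real.cos β - h) / Real.sin β) :
    v ∈ Metric.cthickening η E := by
  have hs : 0 < Real.sin β := Real.sin_pos_of_pos_of_lt_pi hβ (by linarith [Real.pi_pos])
  have hc : 0 < Real.cos β := Real.cos_pos_of_mem_Ioo ⟨by linarith, hβ2⟩
  have hc1 : Real.cos β ≤ 1 := Real.cos_le_one β
  have hs1 : Real.sin β ≤ 1 := Real.sin_le_one β
  have hcs := Real.sin_sq_add_cos_sq β
  set q := Complex.exp (β * Complex.I) with hq
  have hqe : q = (Real.cos β : ℂ) + (Real.sin β : ℂ) * Complex.I := by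
    rw [hq, Complex.exp_mul_I]; simp
  set c := Real.cos β with hcdef
  set s := Real.sin β with hsdef
  have hqre : q.re = c := by rw [hqe]; simp
  have hqim : q.im = s := by rw [hqe]; simp
  have hq1 : ‖q‖ = 1 := Complex.norm_exp_ofReal_mul_I β
  have hqb : ‖1 - q‖ ≤ β := by
    have := Real.norm_exp_I_mul_ofReal_sub_one_le (x := β)
    rw [norm_sub_rev, hq, mul_comm]
    simpa [abs_of_pos hβ] using this
  have hqq : (starRingEnd ℂ) q * q = 1 := by
    rw [← Complex.normSq_eq_conj_mul_self, Complex.normSq_eq_norm_sq, hq1]; simp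
  have huu : (starRingEnd ℂ) u * u = 1 := by
    rw [← Complex.normSq_eq_conj_mul_self, Complex.normSq_eq_norm_sq, hu]; simp
  -- local coordinates
  set Z := (starRingEnd ℂ) u * z with hZ
  set Z' := (starRingEnd ℂ) (u * q) * z' with hZ'
  have ez : z = u * Z := by rw [hZ]; linear_combination (-z) * huu
  have ez' : z' = u * q * Z' := by
    rw [hZ', map_mul]; linear_combination (-z') * huu - z' * (starRingEnd ℂ u * u) * hqq
  have e1 : (starRingEnd ℂ) u * z' = q * Z' := by
    rw [ez']; linear_combination q * Z' * huu
  have e2 : (starRingEnd ℂ) (u * q) * z = (starRingEnd ℂ) q * Z := by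
    rw [map_mul, ez]; linear_combination (starRingEnd ℂ q) * Z * huu
  rw [e1, Complex.mul_re, hqre, hqim] at hle
  rw [e2, Complex.mul_re, Complex.conj_re, Complex.conj_im, hqre, hqim] at hle'
  have hys : y * s = h' - h * c := by rw [hy]; field_simp
  have hxs : x * s = h' * c - h := by rw [hx]; field_simp
  set a := y - Z.im with ha
  set b := Z'.im - x with hb
  have eZ : Z = (h - δ : ℝ) + Complex.I * Z.im := by
    apply Complex.ext <;> simp [hh]
  have eZ' : Z' = (h' - δ : ℝ) + Complex.I * Z'.im := by
    apply Complex.ext <;> simp [hh']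
  have hZre : Z.re = h - δ := by linarith
  have hZre' : Z'.re = h' - δ := by linarith
  rw [hZre'] at hle
  rw [hZre] at hle'
  have ha0 : 0 ≤ a := by
    have : 0 ≤ a * s := by rw [ha]; nlinarith
    exact nonneg_of_mul_nonneg_left this hs
  have hb0 : 0 ≤ b := by
    have : 0 ≤ b * s := by rw [hb]; nlinarith
    exact nonneg_of_mul_nonneg_left this hs
  have d1 : v - z = u * (δ + Complex.I * a) := by
    rw [hv, ez]
    nth_rewrite 1 [eZ]
    rw [ha]; push_cast; ring
  have d2 : v - z' = u * q * (δ - Complex.I * b) := by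
    rw [hv', ez']
    nth_rewrite 1 [eZ']
    rw [hb]; push_cast; ring
  have haD : a ≤ D + δ := by
    have h1 := hD z' hz' z hz
    have e : z' - z = u * (δ + Complex.I * a - q * (δ - Complex.I * b)) := by
      linear_combination d1 - d2
    rw [e, norm_mul, hu, one_mul] at h1
    have h2 := (Complex.abs_im_le_norm (δ + Complex.I * a - q * (δ - Complex.I * b))).trans h1
    have h3 : (δ + Complex.I * a - q * (δ - Complex.I * b)).im = a - s * δ + c * b := by
      simp [Complex.mul_im, hqre, hqim]; ring
    rw [h3] at h2
    have := (le_abs_self _).trans h2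
    have : 0 ≤ c * b := by positivity
    nlinarith
  by_cases hab : a + b = 0
  · have ha' : a = 0 := by linarith
    refine Metric.mem_cthickening_of_dist_le v z η E hz ?_
    rw [dist_eq_norm, d1, ha', norm_mul, hu]
    simp [abs_of_pos hδ]
    have : 0 ≤ (D + δ) * β := mul_nonneg (ha0.trans haD) hβ.le
    linarith
  have habp : 0 < a + b := lt_of_le_of_ne (by linarith) (Ne.symm hab)
  have habC : (a : ℂ) + b ≠ 0 := by exact_mod_cast hab
  have hp := hE hz hz' (a := b / (a + b)) (b := a / (a + b)) (by positivity) (by positivity)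
    (by field_simp; ring)
  refine Metric.mem_cthickening_of_dist_le v _ η E hp ?_
  rw [dist_eq_norm]
  have e : v - ((b / (a + b)) • z + (a / (a + b)) • z') =
      (b / (a + b) : ℝ) * (u * δ) + (a / (a + b) : ℝ) * (u * q * δ) +
      (a * (b / (a + b)) : ℝ) * (Complex.I * u * (1 - q)) := by
    simp only [Complex.real_smul]
    push_cast
    field_simp
    linear_combination (b : ℂ) * d1 + (a : ℂ) * d2
  rw [e]
  refine (norm_add₃_le).trans ?_
  simp only [norm_mul, Complex.norm_real, hu, hq1, Complex.norm_I, one_mul]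
  rw [Real.norm_of_nonneg (by positivity : 0 ≤ b / (a + b)),
    Real.norm_of_nonneg (by positivity : 0 ≤ a / (a + b)),
    Real.norm_of_nonneg hδ.le, Real.norm_of_nonneg ha0]
  have h1 : b / (a + b) * δ + a / (a + b) * δ = δ := by field_simp; ring
  have h2 : a * (b / (a + b)) * ‖1 - q‖ ≤ (D + δ) * β := by
    gcongr
    · exact ha0.trans haD
    · calc a * (b / (a + b)) ≤ a * 1 := by
            gcongr
            rw [div_le_one habp]; linarith
        _ ≤ _ := by linarith
  linarith

lemma edge_log (w c v z0 : ℂ) (l : ℝ) (hw : ‖w‖ = 1) (hc : c = l * (Complex.I * w))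
    (h : 0 < ((starRingEnd ℂ) w * (v - z0)).re) :
    ∫ t in (0:ℝ)..1, c / (v + t * c - z0) =
      Complex.log ((starRingEnd ℂ) w * (v + c - z0)) - Complex.log ((starRingEnd ℂ) w * (v - z0)) := by
  have hww : (starRingEnd ℂ) w * w = 1 := by
    rw [← Complex.normSq_eq_conj_mul_self, Complex.normSq_eq_norm_sq, hw]; simp
  have hre : ∀ t : ℝ, 0 < ((starRingEnd ℂ) w * (v + t * c - z0)).re := by
    intro t
    have : (starRingEnd ℂ) w * (v + t * c - z0) =
        (starRingEnd ℂ) w * (v - z0) + (t * l : ℝ) * Complex.I := by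
      rw [hc]; push_cast; linear_combination (t * l * Complex.I : ℂ) * hww
    rw [this]; simpa using h
  have hne : ∀ t : ℝ, v + t * c - z0 ≠ 0 := by
    intro t h0
    have := hre t
    rw [h0] at this; simp at this
  have hw0 : (starRingEnd ℂ) w ≠ 0 := by
    intro h0; rw [h0] at hww; simp at hww
  have hd : ∀ t : ℝ, HasDerivAt (fun t : ℝ => Complex.log ((starRingEnd ℂ) w * (v + t * c - z0)))
      (c / (v + t * c - z0)) t := by
    intro t
    have h1 : HasDerivAt (fun t : ℝ => (starRingEnd ℂ) w * (v + t * c - z0))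
        ((starRingEnd ℂ) w * (1 * c)) t :=
      ((((Complex.ofRealCLM.hasDerivAt (x := t)).mul_const c).const_add v).sub_const z0).const_mul _
    have h2 := h1.clog_real (Or.inl (hre t))
    convert h2 using 1
    have := hne t
    field_simp
  have := integral_eq_sub_of_hasDerivAt (a := 0) (b := 1) (fun t _ => hd t) (by
    apply Continuous.intervalIntegrable
    have := hne
    fun_prop (disch := exact this))
  rw [this]; simp

lemma log_rot {β : ℝ} (h0 : 0 < β) (h1 : β < Real.pi / 2) {X : ℂ} (hX : 0 < X.re) :
    Complex.log (Complex.exp (β * Complex.I) * X) = β * Complex.I + Complex.log X := by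
  have hX0 : X ≠ 0 := by rintro rfl; simp at hX
  have ha := Complex.abs_arg_lt_pi_div_two_iff.2 (Or.inl hX)
  rw [abs_lt] at ha
  conv_lhs => rw [← Complex.exp_log hX0, ← Complex.exp_add]
  rw [Complex.log_exp]
  · simp [Complex.log_im]; linarith [Real.pi_pos]
  · simp [Complex.log_im]; linarith [Real.pi_pos]

lemma exists_contour {E : Set ℂ} (hEc : IsCompact E) (hE : Convex ℝ E) (hne : E.Nonempty)
    {η : ℝ} (hη : 0 < η) : ∃ δ > 0, Nonempty (PolyContour E δ η) := by
  obtain ⟨z0, hz0⟩ := hne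
  obtain ⟨D, hD⟩ := (Metric.isBounded_iff.1 hEc.isBounded)
  have hD' : ∀ x ∈ E, ∀ y ∈ E, ‖x - y‖ ≤ D := fun x hx y hy => by
    rw [← dist_eq_norm]; exact hD hx hy
  have hD0 : 0 ≤ D := (norm_nonneg _).trans (hD' z0 hz0 z0 hz0)
  set δ := η / 2 with hδd
  have hδ : 0 < δ := by positivity
  obtain ⟨N, hN⟩ := exists_nat_gt (max 4 (2 * Real.pi * (D + δ) / δ))
  have hN4 : (4:ℝ) < N := (le_max_left _ _).trans_lt hN
  have hND : 2 * Real.pi * (D + δ) / δ < N := (le_max_right _ _).trans_lt hN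
  have hNpos : (0:ℝ) < N := by linarith
  set β := 2 * Real.pi / N with hβd
  have hpi := Real.pi_pos
  have hβ : 0 < β := by positivity
  have hβ2 : β < Real.pi / 2 := by
    rw [hβd, div_lt_iff₀ hNpos]; nlinarith
  have hβη : δ + (D + δ) * β ≤ η := by
    have : (D + δ) * β ≤ δ := by
      rw [div_lt_iff₀ hδ] at hND
      rw [hβd, mul_div_assoc', div_le_iff₀ hNpos]; linarith
    linarith
  choose! zm hzm hmax using fun u : ℂ => hEc.exists_isMaxOn ⟨z0, hz0⟩
    (f := fun z => ((starRingEnd ℂ) u * z).re) (by fun_prop)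
  set q := Complex.exp (β * Complex.I) with hq
  have hqe : q = (Real.cos β : ℂ) + (Real.sin β : ℂ) * Complex.I := by
    rw [hq, Complex.exp_mul_I]; simp
  have hs : 0 < Real.sin β := Real.sin_pos_of_pos_of_lt_pi hβ (by linarith)
  have hc1 : Real.cos β ≤ 1 := Real.cos_le_one β
  have hcs : (Real.sin β : ℂ) ^ 2 + (Real.cos β : ℂ) ^ 2 = 1 := by
    exact_mod_cast Real.sin_sq_add_cos_sq β
  have hq1 : ‖q‖ = 1 := Complex.norm_exp_ofReal_mul_I β
  have hqq : (starRingEnd ℂ) q * q = 1 := by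
    rw [← Complex.normSq_eq_conj_mul_self, Complex.normSq_eq_norm_sq, hq1]; simp
  have hqN : q ^ N = 1 := by
    rw [hq, ← Complex.exp_nat_mul, hβd]
    have : (N:ℂ) * (((2 * Real.pi / N : ℝ) : ℂ) * Complex.I) = 2 * Real.pi * Complex.I := by
      push_cast
      have : (N:ℂ) ≠ 0 := by exact_mod_cast hNpos.ne'
      field_simp
    rw [this, Complex.exp_two_pi_mul_I]
  set c := Real.cos β with hcd
  set s := Real.sin β with hsd
  have hsC : (s:ℂ) ≠ 0 := by exact_mod_cast hs.ne'
  set h : ℂ → ℝ := fun u => ((starRingEnd ℂ) u * zm u).re + δ with hh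
  have hle : ∀ u, ∀ z ∈ E, ((starRingEnd ℂ) u * z).re + δ ≤ h u := by
    intro u z hz
    have := hmax u hz
    simp only [Set.mem_setOf_eq] at this
    simp only [hh]; linarith
  set v : ℂ → ℂ := fun u => u * (h u + Complex.I * ((h (u * q) - h u * c) / s : ℝ)) with hvd
  have hv' : ∀ u, v u = u * q * (h (u * q) + Complex.I * ((h (u * q) * c - h u) / s : ℝ)) := by
    intro u
    simp only [hvd]
    generalize h (u * q) = h'
    rw [hqe]
    push_cast
    field_simp
    linear_combination (-(u * h' * Complex.I)) * hcs - (u * s * (h' * c - h u)) * Complex.I_sq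
  have hnorm : ∀ k : ℕ, ‖q ^ k‖ = 1 := fun k => by rw [norm_pow, hq1, one_pow]
  have huu : ∀ k : ℕ, (starRingEnd ℂ) (q ^ k) * q ^ k = 1 := fun k => by
    rw [← Complex.normSq_eq_conj_mul_self, Complex.normSq_eq_norm_sq, hnorm]; simp
  set l : ℕ → ℝ := fun k => (h (q ^ (k + 2)) + h (q ^ k) - 2 * c * h (q ^ (k + 1))) / s with hld
  have hl : ∀ k, 0 ≤ l k := by
    intro k
    refine div_nonneg ?_ hs.le
    have h1 := hle (q ^ (k + 2)) _ (hzm (q ^ (k + 1)))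
    have h2 := hle (q ^ k) _ (hzm (q ^ (k + 1)))
    have h3 : h (q ^ (k + 1)) = ((starRingEnd ℂ) (q ^ (k + 1)) * zm (q ^ (k + 1))).re + δ := rfl
    have h4 : q ^ (k + 2) + q ^ k = ((2 * c : ℝ) : ℂ) * q ^ (k + 1) := by
      have : q ^ 2 + 1 = 2 * c * q := by
        rw [hqe]; linear_combination -hcs + (s:ℂ) ^ 2 * Complex.I_sq
      push_cast
      linear_combination q ^ k * this
    have h5 : ((starRingEnd ℂ) (q ^ (k + 2)) * zm (q ^ (k + 1))).re +
        ((starRingEnd ℂ) (q ^ k) * zm (q ^ (k + 1))).re =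
        2 * c * ((starRingEnd ℂ) (q ^ (k + 1)) * zm (q ^ (k + 1))).re := by
      rw [← Complex.add_re, ← add_mul, ← map_add, h4, map_mul, Complex.conj_ofReal, mul_assoc,
        Complex.re_ofReal_mul]
    nlinarith
  have hvv : ∀ k, v (q ^ (k + 1)) = v (q ^ k) + l k * (Complex.I * q ^ (k + 1)) := by
    intro k
    rw [hv' (q ^ k)]
    simp only [hvd, hld, ← pow_succ]
    push_cast
    field_simp
    ring
  have hsep : ∀ k, ∀ z ∈ E, δ ≤ ((starRingEnd ℂ) (q ^ (k + 1)) * (v (q ^ k) - z)).re := by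
    intro k z hz
    have h1 := hle (q ^ (k + 1)) z hz
    have e : (starRingEnd ℂ) (q ^ (k + 1)) * v (q ^ k) = (h (q ^ (k + 1)) : ℂ) +
        ((h (q ^ (k + 1)) * c - h (q ^ k)) / s : ℝ) * Complex.I := by
      rw [hv' (q ^ k), ← pow_succ, ← mul_assoc, huu]; ring
    rw [mul_sub, Complex.sub_re, e]
    rw [Complex.add_re, Complex.ofReal_re, Complex.re_ofReal_mul, Complex.I_re]
    linarith
  have hvN : v (q ^ N) = v (q ^ 0) := by rw [hqN, pow_zero]
  refine ⟨δ, hδ, ⟨⟨N, fun k => v (q ^ k), fun k => q ^ (k + 1), l, z0, hz0, fun k => hnorm _, hl,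
    hvv, hvN, hsep, ?_, ?_⟩⟩⟩
  · intro k
    exact near_vertex hE hδ hβ hβ2 hD' hβη (q ^ k) (v (q ^ k)) (zm (q ^ k)) (zm (q ^ k * q))
      (h (q ^ k)) (h (q ^ k * q)) _ _ (hnorm k) (hzm _) (hzm _) rfl rfl (hle _ _ (hzm _))
      (hle _ _ (hzm _)) rfl (hv' _) rfl rfl
  · set L : ℕ → ℂ := fun k => Complex.log ((starRingEnd ℂ) (q ^ (k + 1)) * (v (q ^ k) - z0)) with hL
    have hedge : ∀ k, ∫ t in (0:ℝ)..1, (l k * (Complex.I * q ^ (k + 1))) /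
        (v (q ^ k) + t * (l k * (Complex.I * q ^ (k + 1))) - z0) =
        (L (k + 1) - L k) + β * Complex.I := by
      intro k
      have hpos := fun k => hδ.trans_le (hsep k z0 hz0)
      rw [edge_log (q ^ (k + 1)) _ _ z0 (l k) (hnorm _) rfl (hpos k), ← hvv]
      have e : (starRingEnd ℂ) (q ^ (k + 1)) * (v (q ^ (k + 1)) - z0) =
          q * ((starRingEnd ℂ) (q ^ (k + 1 + 1)) * (v (q ^ (k + 1)) - z0)) := by
        rw [pow_succ q (k + 1), map_mul]
        linear_combination (-((starRingEnd ℂ) (q ^ (k + 1)) * (v (q ^ (k + 1)) - z0))) * hqq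
      rw [e, log_rot hβ hβ2 (hpos (k + 1))]
      simp only [hL]; ring
    rw [Finset.sum_congr rfl fun k _ => hedge k, Finset.sum_add_distrib, Finset.sum_range_sub]
    have : L N = L 0 := by simp only [hL, pow_succ, hqN, pow_zero]
    rw [this, hβd]
    simp only [Finset.sum_const, Finset.card_range, nsmul_eq_mul]
    push_cast
    have : (N:ℂ) ≠ 0 := by exact_mod_cast hNpos.ne'
    field_simp
    ring
end ContourExists

section Approx
open MeasureTheory intervalIntegral

variable {E : Set ℂ} {δ η : ℝ}

section
variable {R : Type*} [NormedRing R] [NormedAlgebra ℂ R] [CompleteSpace R]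

lemma map_ringInverse' {R R' : Type*} [Ring R] [Ring R'] [Algebra ℂ R] [Algebra ℂ R']
    (π : R →ₐ[ℂ] R') {x : R} (hx : IsUnit x) : π (Ring.inverse x) = Ring.inverse (π x) := by
  have h1 : π (Ring.inverse x) * π x = 1 := by
    rw [← map_mul, Ring.inverse_mul_cancel _ hx, map_one]
  exact left_inv_eq_right_inv h1 (Ring.mul_inverse_cancel _ (hx.map π))

lemma map_tr {R' : Type*} [NormedRing R'] [NormedAlgebra ℂ R'] [CompleteSpace R']
    (Γ : PolyContour E δ η) (f : Polynomial ℂ) (π : R →ₐ[ℂ] R') (hπ : Continuous π) (a : R)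
    (hu : ∀ k t, IsUnit (algebraMap ℂ R (Γ.s k t) - a)) :
    π (Γ.tr f a) = Γ.tr f (π a) := by
  have hf : ∀ k, Continuous fun t => f.eval (Γ.s k t) :=
    fun k => f.continuous.comp (Γ.s_continuous k)
  have hc := fun k => PolyContour.cont_res (Γ := Γ) (a := a) k (hu k)
  set L : R →L[ℂ] R' := ⟨π.toLinearMap, hπ⟩ with hL
  have hLe : ∀ x, π x = L x := fun x => rfl
  rw [PolyContour.tr, PolyContour.tr, map_smul, map_sum]
  congr 1
  refine Finset.sum_congr rfl fun k _ => ?_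
  rw [hLe, ← L.intervalIntegral_comp_comm]
  · refine integral_congr fun t _ => ?_
    rw [map_smul, ← hLe, map_ringInverse' π (hu k t), map_sub, AlgHom.commutes]
  · apply Continuous.intervalIntegrable
    have := hf k; have := hc k; fun_prop

lemma tr_mem (Γ : PolyContour E δ η) (f : Polynomial ℂ) (a : R)
    (h : ∀ k t, ∃ τ : ℝ, 0 < τ ∧ ‖(τ:ℂ) • (1:R) -
      (starRingEnd ℂ) (Γ.w k) • (algebraMap ℂ R (Γ.s k t) - a)‖ < τ) :
    (∀ k t, IsUnit (algebraMap ℂ R (Γ.s k t) - a)) ∧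
    Γ.tr f a ∈ (Algebra.adjoin ℂ {a}).topologicalClosure := by
  have hu : ∀ k t, IsUnit (algebraMap ℂ R (Γ.s k t) - a) := by
    intro k t
    obtain ⟨τ, hτ, hh⟩ := h k t
    exact isUnit_of_smul (Γ.w_ne k) (neumann_mem _ τ hτ hh).1
  refine ⟨hu, ?_⟩
  set T := (Algebra.adjoin ℂ {a}).topologicalClosure with hT
  have hTc : IsClosed (T : Set R) := Subalgebra.isClosed_topologicalClosure _
  have haT : a ∈ T := Subalgebra.le_topologicalClosure _ (Algebra.self_mem_adjoin_singleton ℂ a)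
  have hres : ∀ k t, Ring.inverse (algebraMap ℂ R (Γ.s k t) - a) ∈ T := by
    intro k t
    obtain ⟨τ, hτ, hh⟩ := h k t
    have h1 := (neumann_mem _ τ hτ hh).2 T hTc
      (T.smul_mem (T.sub_mem (T.algebraMap_mem _) haT) _)
    have e : Ring.inverse (algebraMap ℂ R (Γ.s k t) - a) = (starRingEnd ℂ) (Γ.w k) •
        Ring.inverse ((starRingEnd ℂ) (Γ.w k) • (algebraMap ℂ R (Γ.s k t) - a)) := by
      have hu2 := (neumann_mem _ τ hτ hh).1
      rw [← mul_one (Ring.inverse (algebraMap ℂ R (Γ.s k t) - a)),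
        Ring.inverse_mul_eq_iff_eq_mul _ _ _ (hu k t), mul_smul_comm, ← smul_mul_assoc,
        Ring.mul_inverse_cancel _ hu2]
    rw [e]
    exact T.smul_mem h1 _
  have hf : ∀ k, Continuous fun t => f.eval (Γ.s k t) :=
    fun k => f.continuous.comp (Γ.s_continuous k)
  have hc := fun k => PolyContour.cont_res (Γ := Γ) (a := a) k (hu k)
  rw [PolyContour.tr]
  refine T.smul_mem (T.sum_mem fun k _ => ?_) _
  rw [intervalIntegral.integral_of_le zero_le_one]
  haveI : IsProbabilityMeasure (volume.restrict (Set.Ioc (0:ℝ) 1)) := ⟨by simp⟩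
  have hconv : Convex ℝ (T : Set R) :=
    ((Subalgebra.toSubmodule T).restrictScalars ℝ).convex
  refine hconv.integral_mem hTc (Filter.Eventually.of_forall fun t => T.smul_mem (hres k t) _) ?_
  have : IntervalIntegrable (fun t => (Γ.c k * (starRingEnd ℂ) (f.eval (Γ.s k t))) •
      Ring.inverse (algebraMap ℂ R (Γ.s k t) - a)) volume 0 1 := by
    apply Continuous.intervalIntegrable
    have := hf k; have := hc k; fun_prop
  exact (intervalIntegrable_iff_integrableOn_Ioc_of_le zero_le_one).1 this
end

variable {H : Type*} [NormedAddCommGroup H] [InnerProductSpace ℂ H] [CompleteSpace H]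

set_option maxHeartbeats 1000000 in
lemma tr_approx (hEc : IsCompact E) (hδ : 0 < δ) {S : H →L[ℂ] H} (hS : WIn S E)
    (Γ : PolyContour E δ η) (f : Polynomial ℂ) {ε : ℝ} (hε : 0 < ε) :
    ∃ q : Polynomial ℂ, ‖aeval S q - Γ.tr f S‖ ≤ ε ∧ ∀ z ∈ E, ‖q.eval z - Γ.tr f z‖ ≤ ε := by
  haveI : CompactSpace E := isCompact_iff_compactSpace.1 hEc
  set x : C(E, ℂ) := ⟨fun z => (z : ℂ), continuous_subtype_val⟩ with hx
  set a : C(E, ℂ) × (H →L[ℂ] H) := (x, S) with ha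
  have hh : ∀ k t, ∃ τ : ℝ, 0 < τ ∧ ‖(τ:ℂ) • (1:C(E, ℂ) × (H →L[ℂ] H)) -
      (starRingEnd ℂ) (Γ.w k) • (algebraMap ℂ (C(E, ℂ) × (H →L[ℂ] H)) (Γ.s k t) - a)‖ < τ := by
    intro k t
    set M1 : C(E, ℂ) := (starRingEnd ℂ) (Γ.w k) • (algebraMap ℂ (C(E, ℂ)) (Γ.s k t) - x) with hM1
    set M2 : H →L[ℂ] H := (starRingEnd ℂ) (Γ.w k) • (algebraMap ℂ (H →L[ℂ] H) (Γ.s k t) - S)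
      with hM2
    set τ := (‖M1‖ ^ 2 + ‖M2‖ ^ 2 + 1) / δ with hτd
    have hτ : 0 < τ := by positivity
    have hτδ : τ * δ = ‖M1‖ ^ 2 + ‖M2‖ ^ 2 + 1 := by rw [hτd]; field_simp
    refine ⟨τ, hτ, ?_⟩
    have e : (τ:ℂ) • (1:C(E, ℂ) × (H →L[ℂ] H)) -
      (starRingEnd ℂ) (Γ.w k) • (algebraMap ℂ (C(E, ℂ) × (H →L[ℂ] H)) (Γ.s k t) - a) =
      ((τ:ℂ) • 1 - M1, (τ:ℂ) • 1 - M2) := rfl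
    rw [e, Prod.norm_mk]
    apply max_lt
    · rw [ContinuousMap.norm_lt_iff _ hτ]
      intro z
      have h1 := Γ.s_sep k t z z.2
      have h2 : M1 z = (starRingEnd ℂ) (Γ.w k) * (Γ.s k t - z) := rfl
      have h3 : ‖M1 z‖ ≤ ‖M1‖ := M1.norm_coe_le_norm z
      rw [← h2] at h1
      have h4 : ((τ:ℂ) • (1 : C(E, ℂ)) - M1) z = τ - M1 z := by simp
      rw [h4]
      apply lt_of_pow_lt_pow_left₀ 2 hτ.le
      rw [← Complex.normSq_eq_norm_sq, Complex.normSq_sub, Complex.normSq_ofReal,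
        Complex.normSq_eq_norm_sq, Complex.re_ofReal_mul, Complex.conj_re]
      have h5 : ‖M1 z‖ ^ 2 ≤ ‖M1‖ ^ 2 := by gcongr
      have h6 : τ * δ ≤ τ * (M1 z).re := by gcongr
      nlinarith [sq_nonneg ‖M1‖, sq_nonneg ‖M2‖]
    · refine near_tau M2 δ τ hτ (fun y => hS.coercive Γ k t y) ?_
      nlinarith [sq_nonneg ‖M1‖, sq_nonneg ‖M2‖]
  obtain ⟨hu, hmem⟩ := tr_mem Γ f a hh
  have h2 := map_tr Γ f (AlgHom.snd ℂ C(E, ℂ) (H →L[ℂ] H)) continuous_snd a hu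
  rw [← SetLike.mem_coe, Subalgebra.topologicalClosure_coe, Metric.mem_closure_iff] at hmem
  obtain ⟨b, hb, hd⟩ := hmem ε hε
  rw [SetLike.mem_coe, Algebra.adjoin_singleton_eq_range_aeval] at hb
  obtain ⟨q, rfl⟩ := hb
  rw [dist_comm, dist_eq_norm] at hd
  refine ⟨q, ?_, fun z hz => ?_⟩
  · have h3 := (norm_snd_le (aeval a q - Γ.tr f a)).trans hd.le
    have h4 : (aeval a q - Γ.tr f a).2 = aeval S q - Γ.tr f S := by
      have h5 : AlgHom.snd ℂ C(E, ℂ) (H →L[ℂ] H) (aeval a q) = aeval S q := by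
        rw [← Polynomial.aeval_algHom_apply]; rfl
      rw [← h5]
      have h6 : AlgHom.snd ℂ C(E, ℂ) (H →L[ℂ] H) a = S := rfl
      rw [h6] at h2
      rw [← h2]; rfl
    rwa [h4] at h3
  · set π : C(E, ℂ) × (H →L[ℂ] H) →ₐ[ℂ] ℂ :=
      (ContinuousMap.evalAlgHom ℂ ℂ (⟨z, hz⟩ : E)).comp (AlgHom.fst ℂ C(E, ℂ) (H →L[ℂ] H)) with hπ
    have hπc : Continuous π := (continuous_eval_const (⟨z, hz⟩ : E)).comp continuous_fst
    have h7 := map_tr Γ f π hπc a hu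
    have hπa : π a = z := rfl
    have h8 : π (aeval a q) = q.eval z := by
      rw [← Polynomial.aeval_algHom_apply, hπa, Polynomial.coe_aeval_eq_eval]
    rw [hπa] at h7
    rw [← h8, ← h7, ← map_sub]
    exact ((ContinuousMap.norm_coe_le_norm _ _).trans (norm_fst_le (aeval a q - Γ.tr f a))).trans hd.le

lemma tr_bound (hE : Convex ℝ E) (hδ : 0 < δ)
    (Γ : PolyContour E δ η) (f : Polynomial ℂ) (M : ℝ)
    (hM : ∀ z ∈ Metric.cthickening η E, ‖f.eval z‖ ≤ M) {z : ℂ} (hz : z ∈ E) :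
    ‖Γ.tr f z‖ ≤ 3 * M := by
  have hW : WIn (algebraMap ℂ (ℂ →L[ℂ] ℂ) z) E := by
    intro x
    refine ⟨z, hz, ?_⟩
    have : (algebraMap ℂ (ℂ →L[ℂ] ℂ) z) x = z • x := by
      simp [Algebra.algebraMap_eq_smul_one]
    rw [this, inner_smul_right, inner_self_eq_norm_sq_to_K]
    push_cast
    simp only [Complex.coe_algebraMap]
    ring
  have h := norm_rep_le hW hE hδ Γ f M hM
  have hu : ∀ k t, IsUnit (algebraMap ℂ ℂ (Γ.s k t) - z) := by
    intro k t
    rw [isUnit_iff_ne_zero]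
    intro h0
    have := Γ.s_sep k t z hz
    simp only [Algebra.algebraMap_self, RingHom.id_apply] at h0
    rw [h0] at this
    simp at this
    linarith
  have h1 := map_tr Γ f (Algebra.ofId ℂ (ℂ →L[ℂ] ℂ)) (continuous_algebraMap ℂ (ℂ →L[ℂ] ℂ)) z hu
  have h2 : Γ.tr f (algebraMap ℂ (ℂ →L[ℂ] ℂ) z) = algebraMap ℂ (ℂ →L[ℂ] ℂ) (Γ.tr f z) := h1.symm
  rw [h2, Polynomial.aeval_algebraMap_apply_eq_algebraMap_eval, ← algebraMap_star_comm, ← map_add,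
    norm_algebraMap'] at h
  have h3 := hM z (Metric.self_subset_cthickening E hz)
  have h4 : ‖star (Γ.tr f z)‖ ≤ ‖eval z f + star (Γ.tr f z)‖ + ‖eval z f‖ := by
    have := norm_sub_le (eval z f + star (Γ.tr f z)) (eval z f)
    simpa using this
  rw [norm_star] at h4
  linarith

end Approx

section Crouzeix
open MeasureTheory intervalIntegral

variable {E : Set ℂ} {δ η : ℝ}
variable {H : Type*} [NormedAddCommGroup H] [InnerProductSpace ℂ H] [CompleteSpace H]

lemma WIn.mono {S : H →L[ℂ] H} {E F : Set ℂ} (hS : WIn S E) (h : E ⊆ F) : WIn S F := by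
  intro x
  obtain ⟨ξ, hξ, e⟩ := hS x
  exact ⟨ξ, h hξ, e⟩

lemma cauchy_bound (hE : Convex ℝ E) (hδ : 0 < δ) {S : H →L[ℂ] H} (hS : WIn S E)
    (Γ : PolyContour E δ η) : ∃ K : ℝ, ∀ f : Polynomial ℂ,
      (∀ z ∈ Metric.cthickening η E, ‖f.eval z‖ ≤ 1) → ‖aeval S f‖ ≤ K := by
  have hc := fun k => PolyContour.cont_res (Γ := Γ) (a := S) k (hS.isUnit hδ Γ k)
  have hb : ∀ k, ∃ C, ∀ t ∈ Set.Icc (0:ℝ) 1,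
      ‖Ring.inverse (algebraMap ℂ (H →L[ℂ] H) (Γ.s k t) - S)‖ ≤ C := fun k =>
    isCompact_Icc.exists_bound_of_continuousOn (hc k).continuousOn
  choose C hC using hb
  refine ⟨‖(2 * Real.pi * Complex.I : ℂ)⁻¹‖ * ∑ k ∈ Finset.range Γ.N, ‖Γ.c k‖ * C k, ?_⟩
  intro f hf
  have hpi : (2 * Real.pi * Complex.I : ℂ) ≠ 0 := by simp [Real.pi_ne_zero]
  have h1 : aeval S f = (2 * Real.pi * Complex.I : ℂ)⁻¹ • ∑ k ∈ Finset.range Γ.N,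
      ∫ t in (0:ℝ)..1, (Γ.c k * f.eval (Γ.s k t)) •
      Ring.inverse (algebraMap ℂ (H →L[ℂ] H) (Γ.s k t) - S) := by
    rw [PolyContour.cauchy hδ (hS.good hE hδ Γ) f, smul_smul, inv_mul_cancel₀ hpi, one_smul]
  rw [h1, norm_smul]
  refine mul_le_mul_of_nonneg_left ((norm_sum_le _ _).trans (Finset.sum_le_sum fun k _ => ?_))
    (norm_nonneg _)
  have : ‖∫ t in (0:ℝ)..1, (Γ.c k * f.eval (Γ.s k t)) •
      Ring.inverse (algebraMap ℂ (H →L[ℂ] H) (Γ.s k t) - S)‖ ≤ ‖Γ.c k‖ * C k * |1 - 0| := by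
    apply intervalIntegral.norm_integral_le_of_norm_le_const
    intro t ht
    rw [Set.uIoc_of_le zero_le_one] at ht
    have ht' : t ∈ Set.Icc (0:ℝ) 1 := ⟨ht.1.le, ht.2⟩
    rw [norm_smul, norm_mul]
    have h2 := hf _ (Γ.s_mem hE k t ht')
    have h3 := hC k t ht'
    have h4 : ‖Γ.c k‖ * ‖f.eval (Γ.s k t)‖ ≤ ‖Γ.c k‖ := mul_le_of_le_one_right (norm_nonneg _) h2
    gcongr
  simpa using this

lemma exists_thick {E : Set ℂ} (hEc : IsCompact E) (f : Polynomial ℂ) {M M' : ℝ} (hMM : M < M')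
    (hM : ∀ z ∈ E, ‖f.eval z‖ ≤ M) :
    ∃ η > 0, ∀ z ∈ Metric.cthickening η E, ‖f.eval z‖ ≤ M' := by
  have ho : IsOpen {z : ℂ | ‖f.eval z‖ < M'} :=
    isOpen_lt (f.continuous.norm) continuous_const
  obtain ⟨η, hη, h⟩ := hEc.exists_cthickening_subset_open ho
    (fun z hz => (hM z hz).trans_lt hMM)
  exact ⟨η, hη, fun z hz => (h hz).le⟩

lemma cubic_step (hEc : IsCompact E) (hE : Convex ℝ E) {S : H →L[ℂ] H} (hS : WIn S E)
    {K : ℝ} (hK : ∀ f : Polynomial ℂ, (∀ z ∈ E, ‖f.eval z‖ ≤ 1) → ‖aeval S f‖ ≤ K)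
    (f : Polynomial ℂ) (hf : ∀ z ∈ E, ‖f.eval z‖ ≤ 1) :
    ‖aeval S f‖ ^ 4 ≤ 3 * ‖aeval S f‖ ^ 3 + 4 * K * ‖aeval S f‖ := by
  have hne : E.Nonempty := by obtain ⟨ξ, hξ, _⟩ := hS 0; exact ⟨ξ, hξ⟩
  obtain ⟨η, hη, hf'⟩ := exists_thick hEc f (by norm_num : (1:ℝ) < 5 / 4) hf
  obtain ⟨δ, hδ, ⟨Γ⟩⟩ := exists_contour hEc hE hne hη
  obtain ⟨q, hq1, hq2⟩ := tr_approx hEc hδ hS Γ f (by norm_num : (0:ℝ) < 1 / 4)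
  have h1 := norm_rep_le hS hE hδ Γ f _ hf'
  set F := aeval S f with hF
  set Q := aeval S q with hQ
  have h2 : ‖F + star Q‖ ≤ 3 := by
    have : F + star Q = (F + star (Γ.tr f S)) + star (Q - Γ.tr f S) := by
      rw [star_sub]; abel
    rw [this]
    refine (norm_add_le _ _).trans ?_
    rw [norm_star]; linarith
  have h3 : ∀ z ∈ E, ‖q.eval z‖ ≤ 4 := by
    intro z hz
    have h4 := hq2 z hz
    have h5 := tr_bound hE hδ Γ f _ hf' hz
    have : q.eval z = (q.eval z - Γ.tr f z) + Γ.tr f z := by ring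
    rw [this]
    refine (norm_add_le _ _).trans ?_
    linarith
  have h4 : ‖F * Q * F‖ ≤ 4 * K := by
    have := hK (Polynomial.C (1 / 4 : ℂ) * (f * q * f)) (by
      intro z hz
      have a1 := hf z hz
      have a2 := h3 z hz
      rw [eval_mul, eval_mul, eval_mul, eval_C, norm_mul, norm_mul, norm_mul]
      have a3 : ‖eval z f‖ * ‖eval z q‖ * ‖eval z f‖ ≤ 1 * 4 * 1 := by gcongr
      have a4 : ‖(1 / 4 : ℂ)‖ = 1 / 4 := by simp
      rw [a4]; linarith)
    rw [map_mul, map_mul, map_mul, aeval_C, ← hF, ← hQ, ← Algebra.smul_def, norm_smul] at this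
    have a4 : ‖(1 / 4 : ℂ)‖ = 1 / 4 := by simp
    rw [a4] at this; linarith
  have e : (F * star F) * (F * star F) = F * star (F + star Q) * F * star F -
      (F * Q * F) * star F := by
    rw [star_add, star_star]; noncomm_ring
  have h5 : ‖(F * star F) * (F * star F)‖ = ‖F‖ ^ 4 := by
    have : (F * star F) * (F * star F) = (F * star F) * star (F * star F) := by
      rw [star_mul, star_star]
    rw [this, CStarRing.norm_self_mul_star, CStarRing.norm_self_mul_star]; ring
  rw [← h5, e]
  refine (norm_sub_le _ _).trans ?_
  have h6 : ‖F * star (F + star Q) * F * star F‖ ≤ ‖F‖ * 3 * ‖F‖ * ‖F‖ := by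
    calc _ ≤ ‖F‖ * ‖star (F + star Q)‖ * ‖F‖ * ‖star F‖ := by
          refine (norm_mul_le _ _).trans ?_
          gcongr
          refine (norm_mul_le _ _).trans ?_
          gcongr
          exact norm_mul_le _ _
      _ ≤ _ := by rw [norm_star, norm_star]; gcongr
  have h7 : ‖F * Q * F * star F‖ ≤ 4 * K * ‖F‖ := by
    refine (norm_mul_le _ _).trans ?_
    rw [norm_star]; gcongr
  calc _ ≤ _ := add_le_add h6 h7
    _ = _ := by ring

lemma four_of_bounded (hEc : IsCompact E) (hE : Convex ℝ E) {S : H →L[ℂ] H} (hS : WIn S E)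
    {K0 : ℝ} (hK0 : ∀ f : Polynomial ℂ, (∀ z ∈ E, ‖f.eval z‖ ≤ 1) → ‖aeval S f‖ ≤ K0)
    (f : Polynomial ℂ) (hf : ∀ z ∈ E, ‖f.eval z‖ ≤ 1) : ‖aeval S f‖ ≤ 4 := by
  set X : Set ℝ := {x | ∃ f : Polynomial ℂ, (∀ z ∈ E, ‖f.eval z‖ ≤ 1) ∧ x = ‖aeval S f‖} with hX
  have hb : BddAbove X := ⟨K0, by rintro x ⟨f, hf, rfl⟩; exact hK0 f hf⟩
  have hne : X.Nonempty := ⟨_, f, hf, rfl⟩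
  set K := sSup X with hKd
  have hK : ∀ f : Polynomial ℂ, (∀ z ∈ E, ‖f.eval z‖ ≤ 1) → ‖aeval S f‖ ≤ K :=
    fun f hf => le_csSup hb ⟨f, hf, rfl⟩
  refine (hK f hf).trans ?_
  by_contra hcon
  push Not at hcon
  set x0 := (4 + K) / 2 with hx0
  have hx04 : 4 < x0 := by rw [hx0]; linarith
  have hc0 : 4 < x0 * (x0 - 3) := by nlinarith
  have hlt : max x0 (4 * K / (x0 * (x0 - 3))) < K := by
    apply max_lt
    · rw [hx0]; linarith
    · rw [div_lt_iff₀ (by linarith)]; nlinarith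
  obtain ⟨x, ⟨g, hg, rfl⟩, hx⟩ := exists_lt_of_lt_csSup hne hlt
  have hs := cubic_step hEc hE hS hK g hg
  set x := ‖aeval S g‖
  have hx1 : x0 < x := (le_max_left _ _).trans_lt hx
  have hx2 : 4 * K / (x0 * (x0 - 3)) < x := (le_max_right _ _).trans_lt hx
  rw [div_lt_iff₀ (by linarith)] at hx2
  have hxp : 0 < x := by linarith
  have h1 : x * (x0 * (x0 - 3)) ≤ x * (x * (x - 3)) := by
    apply mul_le_mul_of_nonneg_left _ hxp.le
    nlinarith
  have h2 : 4 * K < x * (x * (x - 3)) := by linarith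
  have h3 : 4 * K * x < x * (x * (x - 3)) * x := by gcongr
  nlinarith

/-- Functional calculus bound with constant 4. -/
theorem fc_bound (hEc : IsCompact E) (hE : Convex ℝ E) {S : H →L[ℂ] H} (hS : WIn S E)
    (p : Polynomial ℂ) (M : ℝ) (hp : ∀ z ∈ E, ‖p.eval z‖ ≤ M) : ‖aeval S p‖ ≤ 4 * M := by
  obtain ⟨ξ, hξ, _⟩ := hS 0
  have hM0 : 0 ≤ M := (norm_nonneg _).trans (hp ξ hξ)
  refine le_of_forall_pos_le_add fun ε hε => ?_
  set M' := M + ε / 4 with hM'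
  have hM'p : 0 < M' := by positivity
  obtain ⟨δ, hδ, hd⟩ := exists_thick hEc p (by linarith : M < M') hp
  obtain ⟨δ', hδ', ⟨Γ⟩⟩ := exists_contour hEc hE ⟨ξ, hξ⟩ hδ
  obtain ⟨K0, hK0⟩ := cauchy_bound hE hδ' hS Γ
  have h := four_of_bounded hEc.cthickening (hE.cthickening δ)
    (hS.mono (Metric.self_subset_cthickening E)) hK0 (Polynomial.C ((M' : ℂ)⁻¹) * p) (by
      intro z hz
      rw [eval_mul, eval_C, norm_mul, norm_inv, Complex.norm_real, Real.norm_of_nonneg hM'p.le,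
        inv_mul_le_iff₀ hM'p]
      simpa using hd z hz)
  rw [map_mul, aeval_C, ← Algebra.smul_def, norm_smul, norm_inv, Complex.norm_real,
    Real.norm_of_nonneg hM'p.le, inv_mul_le_iff₀ hM'p] at h
  linarith

end Crouzeix

section DividedDiff
open MeasureTheory intervalIntegral

section
variable {R : Type*} [NormedRing R] [NormedAlgebra ℂ R] [CompleteSpace R]

/-- segment between two algebra elements -/
noncomputable def seg (L N : R) (t : ℝ) : R := (t:ℂ) • L + ((1 - t : ℝ) : ℂ) • N

lemma seg_cont (L N : R) : Continuous (seg L N) := by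
  unfold seg; fun_prop

lemma seg_pow_deriv {L N : R} (h : Commute L N) (j : ℕ) (t : ℝ) :
    HasDerivAt (fun t => seg L N t ^ j) ((j:ℂ) • ((L - N) * seg L N t ^ (j - 1))) t := by
  have h1 : HasDerivAt (fun t => seg L N t) (L - N) t := by
    have a1 : HasDerivAt (fun t : ℝ => (t:ℂ) • L) ((1:ℂ) • L) t :=
      (Complex.ofRealCLM.hasDerivAt (x := t)).smul_const L
    have a2 : HasDerivAt (fun t : ℝ => (1 - t : ℂ) • N) ((-1:ℂ) • N) t :=
      ((Complex.ofRealCLM.hasDerivAt (x := t)).const_sub 1).smul_const N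
    have a3 := a1.add a2
    have e : (fun t => seg L N t) = (fun t : ℝ => (t:ℂ) • L) + fun t : ℝ => (1 - t : ℂ) • N := by
      funext t; simp [seg]
    have e2 : L - N = (1:ℂ) • L + (-1:ℂ) • N := by module
    rw [e, e2]; exact a3
  have hcomm : ∀ t, Commute (seg L N t) (L - N) := by
    intro t
    unfold seg
    have c1 : Commute L (L - N) := (Commute.refl L).sub_right h
    have c2 : Commute N (L - N) := h.symm.sub_right (Commute.refl N)
    exact (c1.smul_left _).add_left (c2.smul_left _)
  induction j with
  | zero => simpa using hasDerivAt_const t (1:R)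
  | succ j ih =>
    have := h1.mul ih
    convert this using 1
    · ext t; simp [pow_succ']
    · rw [mul_smul_comm, ← mul_assoc, (hcomm t).eq, mul_assoc]
      rcases j with _ | j
      · simp
      · simp only [Nat.add_sub_cancel]
        rw [← pow_succ']
        push_cast
        rw [add_smul _ (1:ℂ), one_smul, add_comm]

lemma seg_int {L N : R} (h : Commute L N) (j : ℕ) :
    ((j + 1 : ℕ) : ℂ) • (∫ t in (0:ℝ)..1, seg L N t ^ j) =
      L ^ j + N * ((j:ℂ) • ∫ t in (0:ℝ)..1, seg L N t ^ (j - 1)) := by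
  have hs := seg_cont L N
  have hd : ∀ t, HasDerivAt (fun t : ℝ => (t:ℂ) • seg L N t ^ j)
      (((j + 1 : ℕ) : ℂ) • seg L N t ^ j - (j:ℂ) • (N * seg L N t ^ (j - 1))) t := by
    intro t
    have h1 := (Complex.ofRealCLM.hasDerivAt (x := t)).smul (seg_pow_deriv h j t)
    refine h1.congr_deriv ?_
    rcases j with _ | j
    · simp
    · simp only [Nat.add_sub_cancel, Complex.ofRealCLM_apply, Complex.ofReal_one, one_smul]
      have e : (t:ℂ) • (L - N) = seg L N t - N := by
        unfold seg; push_cast; module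
      rw [smul_comm, ← smul_mul_assoc, e, sub_mul, ← pow_succ', smul_sub]
      push_cast
      module
  have := integral_eq_sub_of_hasDerivAt (a := 0) (b := 1) (fun t _ => hd t)
    (by apply Continuous.intervalIntegrable; fun_prop)
  rw [intervalIntegral.integral_sub, intervalIntegral.integral_smul, intervalIntegral.integral_smul] at this
  · have e2 : ∫ t in (0:ℝ)..1, N * seg L N t ^ (j - 1) = N * ∫ t in (0:ℝ)..1, seg L N t ^ (j - 1) := by
      have := (ContinuousLinearMap.mul ℂ R N).intervalIntegral_comp_comm (μ := volume) (a := 0) (b := 1)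
        (f := fun t => seg L N t ^ (j - 1)) (by apply Continuous.intervalIntegrable; fun_prop)
      simpa using this
    rw [e2] at this
    rw [mul_smul_comm]
    rw [sub_eq_iff_eq_add] at this
    rw [this]
    simp [seg]
  · apply Continuous.intervalIntegrable; fun_prop
  · apply Continuous.intervalIntegrable; fun_prop
end

end DividedDiff

section MatrixPart
variable {k l : ℕ}

/-- vectorization -/
noncomputable def vecE (k l : ℕ) :
    Matrix (Fin k) (Fin l) ℂ ≃ₗ[ℂ] EuclideanSpace ℂ (Fin k × Fin l) where
  toFun X := WithLp.toLp 2 (fun p => X p.1 p.2)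
  invFun x := Matrix.of fun i j => x (i, j)
  map_add' _ _ := rfl
  map_smul' _ _ := rfl
  left_inv _ := rfl
  right_inv _ := rfl

lemma vecE_norm (X : Matrix (Fin k) (Fin l) ℂ) : ‖vecE k l X‖ = frobNorm X := by
  rw [EuclideanSpace.norm_eq, frobNorm, Fintype.sum_prod_type]; rfl

/-- linear operator on matrices as an operator on the Hilbert space -/
noncomputable def opE (φ : Matrix (Fin k) (Fin l) ℂ →ₗ[ℂ] Matrix (Fin k) (Fin l) ℂ) :
    EuclideanSpace ℂ (Fin k × Fin l) →L[ℂ] EuclideanSpace ℂ (Fin k × Fin l) :=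
  LinearMap.toContinuousLinearMap ((vecE k l).toLinearMap ∘ₗ φ ∘ₗ (vecE k l).symm.toLinearMap)

lemma opE_apply (φ : Matrix (Fin k) (Fin l) ℂ →ₗ[ℂ] Matrix (Fin k) (Fin l) ℂ)
    (X : Matrix (Fin k) (Fin l) ℂ) : opE φ (vecE k l X) = vecE k l (φ X) := by
  simp [opE]

/-- left multiplication -/
noncomputable def Lop (l : ℕ) (M : Matrix (Fin k) (Fin k) ℂ) :
    EuclideanSpace ℂ (Fin k × Fin l) →L[ℂ] EuclideanSpace ℂ (Fin k × Fin l) :=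
  opE { toFun := fun X => M * X, map_add' := fun X Y => Matrix.mul_add M X Y,
        map_smul' := fun c X => by simp }

/-- right multiplication -/
noncomputable def Rop (k : ℕ) (N : Matrix (Fin l) (Fin l) ℂ) :
    EuclideanSpace ℂ (Fin k × Fin l) →L[ℂ] EuclideanSpace ℂ (Fin k × Fin l) :=
  opE { toFun := fun X => X * N, map_add' := fun X Y => Matrix.add_mul X Y N,
        map_smul' := fun c X => by simp }

lemma Lop_apply (M : Matrix (Fin k) (Fin k) ℂ) (X : Matrix (Fin k) (Fin l) ℂ) :
    Lop l M (vecE k l X) = vecE k l (M * X) := opE_apply _ X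

lemma Rop_apply (N : Matrix (Fin l) (Fin l) ℂ) (X : Matrix (Fin k) (Fin l) ℂ) :
    Rop k N (vecE k l X) = vecE k l (X * N) := opE_apply _ X

lemma Lop_pow (M : Matrix (Fin k) (Fin k) ℂ) (X : Matrix (Fin k) (Fin l) ℂ) (j : ℕ) :
    (Lop l M ^ j) (vecE k l X) = vecE k l (M ^ j * X) := by
  induction j with
  | zero => simp
  | succ j ih =>
    rw [pow_succ', pow_succ', ContinuousLinearMap.mul_apply, ih, Lop_apply, Matrix.mul_assoc]

lemma LR_comm (M : Matrix (Fin k) (Fin k) ℂ) (N : Matrix (Fin l) (Fin l) ℂ) :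
    Commute (Lop l M) (Rop k N) := by
  ext1 x
  obtain ⟨X, rfl⟩ := (vecE k l).surjective x
  rw [ContinuousLinearMap.mul_apply, ContinuousLinearMap.mul_apply, Rop_apply, Lop_apply, Lop_apply,
    Rop_apply, Matrix.mul_assoc]

lemma block_int (M : Matrix (Fin k) (Fin k) ℂ) (N : Matrix (Fin l) (Fin l) ℂ)
    (D : Matrix (Fin k) (Fin l) ℂ) (g : Polynomial ℂ) :
    vecE k l (aeval (Matrix.fromBlocks M D 0 N) g).toBlocks₁₂ =
      (∫ t in (0:ℝ)..1, aeval (seg (Lop l M) (Rop k N) t) (derivative g)) (vecE k l D) := by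
  have hs := seg_cont (Lop l M) (Rop k N)
  have hcont : ∀ p : Polynomial ℂ, Continuous fun t => aeval (seg (Lop l M) (Rop k N) t) p :=
    fun p => (Polynomial.continuous_aeval p).comp hs
  have hpow : ∀ j, ∃ P Q : _, (Matrix.fromBlocks M D 0 N) ^ j =
      Matrix.fromBlocks (M ^ j) P 0 Q ∧ Q = N ^ j ∧
      vecE k l P = ((j:ℂ) • ∫ t in (0:ℝ)..1, seg (Lop l M) (Rop k N) t ^ (j - 1)) (vecE k l D) := by
    intro j
    induction j with
    | zero => exact ⟨0, 1, by simp [Matrix.fromBlocks_one], by simp, by simp⟩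
    | succ j ih =>
      obtain ⟨P, Q, h1, h2, h3⟩ := ih
      refine ⟨M ^ j * D + P * N, N ^ (j + 1), ?_, rfl, ?_⟩
      · rw [pow_succ, h1, h2, Matrix.fromBlocks_multiply]
        simp [pow_succ]
      · rw [Nat.add_sub_cancel, seg_int (LR_comm M N), map_add, ContinuousLinearMap.add_apply,
          ContinuousLinearMap.mul_apply, ← h3, Lop_pow, Rop_apply]
  induction g using Polynomial.induction_on' with
  | add p q hp hq =>
    have : (aeval (Matrix.fromBlocks M D 0 N) (p + q)).toBlocks₁₂ =
        (aeval (Matrix.fromBlocks M D 0 N) p).toBlocks₁₂ +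
        (aeval (Matrix.fromBlocks M D 0 N) q).toBlocks₁₂ := by rw [map_add]; rfl
    rw [this, map_add, hp, hq, ← ContinuousLinearMap.add_apply, derivative_add,
      ← intervalIntegral.integral_add]
    · simp
    · exact (hcont _).intervalIntegrable _ _
    · exact (hcont _).intervalIntegrable _ _
  | monomial j a =>
    obtain ⟨P, Q, h1, h2, h3⟩ := hpow j
    rw [derivative_monomial]
    simp only [aeval_monomial, ← Algebra.smul_def]
    rw [h1]
    have : (a • Matrix.fromBlocks (M ^ j) P 0 Q).toBlocks₁₂ = a • P := by
      ext i j; rfl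
    rw [this, map_smul, h3, intervalIntegral.integral_smul]
    simp [mul_smul]

lemma convex_comb {E : Set ℂ} (hE : Convex ℝ E) (hne : E.Nonempty) {ι : Type*} (s : Finset ι)
    (c : ι → ℝ) (hc : ∀ i, 0 ≤ c i) (ξ : ι → ℂ) (hξ : ∀ i, ξ i ∈ E) :
    ∃ z ∈ E, ∑ i ∈ s, (c i : ℂ) * ξ i = ((∑ i ∈ s, c i : ℝ) : ℂ) * z := by
  by_cases h : ∑ i ∈ s, c i = 0
  · obtain ⟨z, hz⟩ := hne
    refine ⟨z, hz, ?_⟩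
    have := (Finset.sum_eq_zero_iff_of_nonneg (fun i _ => hc i)).1 h
    rw [h, Finset.sum_eq_zero]
    · simp
    · intro i hi; rw [this i hi]; simp
  · have hp : 0 < ∑ i ∈ s, c i := lt_of_le_of_ne (Finset.sum_nonneg fun i _ => hc i) (Ne.symm h)
    refine ⟨_, hE.centerMass_mem (fun i _ => hc i) hp (fun i _ => hξ i), ?_⟩
    rw [Finset.centerMass]
    simp only [Complex.real_smul]
    have : ((∑ i ∈ s, c i : ℝ) : ℂ) ≠ 0 := by exact_mod_cast h
    rw [← mul_assoc]
    simp only [Complex.ofReal_inv]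
    rw [mul_inv_cancel₀ this, one_mul]

lemma numRange_quad {E : Set ℂ} (hne : E.Nonempty) {M : Matrix (Fin k) (Fin k) ℂ}
    (hM : numRange M ⊆ E) (x : Fin k → ℂ) :
    ∃ ξ ∈ E, star x ⬝ᵥ M.mulVec x = ((∑ i, ‖x i‖ ^ 2 : ℝ) : ℂ) * ξ := by
  have hxx : star x ⬝ᵥ x = ((∑ i, ‖x i‖ ^ 2 : ℝ) : ℂ) := by
    simp only [dotProduct, Pi.star_apply]
    push_cast
    refine Finset.sum_congr rfl fun i _ => ?_
    exact Complex.conj_mul' (x i)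
  set r := ∑ i, ‖x i‖ ^ 2 with hr
  have hr0 : 0 ≤ r := Finset.sum_nonneg fun i _ => by positivity
  by_cases h : r = 0
  · obtain ⟨z, hz⟩ := hne
    refine ⟨z, hz, ?_⟩
    have hx : x = 0 := by
      funext i
      have := (Finset.sum_eq_zero_iff_of_nonneg (fun i _ => by positivity)).1 h i (Finset.mem_univ i)
      simpa using this
    rw [h, hx]; simp
  · have hp : 0 < r := lt_of_le_of_ne hr0 (Ne.symm h)
    set c : ℂ := (((Real.sqrt r)⁻¹ : ℝ) : ℂ) with hc
    have hcc : star c * c = (r:ℂ)⁻¹ := by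
      rw [hc]
      simp only [RCLike.star_def, Complex.conj_ofReal]
      rw [← Complex.ofReal_mul, ← mul_inv, Real.mul_self_sqrt hr0]
      push_cast; rfl
    have hrC : (r:ℂ) ≠ 0 := by exact_mod_cast h
    refine ⟨star (c • x) ⬝ᵥ M.mulVec (c • x), hM ⟨c • x, ?_, rfl⟩, ?_⟩
    · rw [star_smul, smul_dotProduct, dotProduct_smul, hxx, smul_eq_mul, smul_eq_mul, ← mul_assoc,
        hcc, inv_mul_cancel₀ hrC]
    · rw [star_smul, Matrix.mulVec_smul, smul_dotProduct, dotProduct_smul, smul_eq_mul, smul_eq_mul,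
        ← mul_assoc (star c), hcc, ← mul_assoc, mul_inv_cancel₀ hrC, one_mul]

lemma vecE_inner (X Y : Matrix (Fin k) (Fin l) ℂ) :
    inner ℂ (vecE k l X) (vecE k l Y) = ∑ i, ∑ j, star (X i j) * Y i j := by
  rw [PiLp.inner_apply, Fintype.sum_prod_type]
  refine Finset.sum_congr rfl fun i _ => Finset.sum_congr rfl fun j _ => ?_
  rw [RCLike.inner_apply, mul_comm]; rfl

lemma vecE_norm_sq (X : Matrix (Fin k) (Fin l) ℂ) :
    ‖vecE k l X‖ ^ 2 = ∑ i, ∑ j, ‖X i j‖ ^ 2 := by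
  rw [vecE_norm, frobNorm, Real.sq_sqrt]
  exact Finset.sum_nonneg fun i _ => Finset.sum_nonneg fun j _ => by positivity

lemma Lop_WIn {E : Set ℂ} (hE : Convex ℝ E) (hne : E.Nonempty) {M : Matrix (Fin k) (Fin k) ℂ}
    (hM : numRange M ⊆ E) : WIn (Lop l M) E := by
  intro x
  obtain ⟨X, rfl⟩ := (vecE k l).surjective x
  choose ξ hξ hq using fun j => numRange_quad hne hM (fun i => X i j)
  obtain ⟨z, hz, h⟩ := convex_comb hE hne Finset.univ (fun j => ∑ i, ‖X i j‖ ^ 2)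
    (fun j => Finset.sum_nonneg fun i _ => by positivity) ξ hξ
  refine ⟨z, hz, ?_⟩
  rw [Lop_apply, vecE_inner, vecE_norm_sq, Finset.sum_comm, Finset.sum_comm (s := Finset.univ)
    (t := Finset.univ) (f := fun i j => ‖X i j‖ ^ 2), ← h]
  refine Finset.sum_congr rfl fun j _ => ?_
  rw [← hq j]; rfl

lemma Rop_WIn {E : Set ℂ} (hE : Convex ℝ E) (hne : E.Nonempty) {N : Matrix (Fin l) (Fin l) ℂ}
    (hN : numRange N ⊆ E) : WIn (Rop k N) E := by
  intro x
  obtain ⟨X, rfl⟩ := (vecE k l).surjective x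
  choose ξ hξ hq using fun i => numRange_quad hne hN (fun j => star (X i j))
  obtain ⟨z, hz, h⟩ := convex_comb hE hne Finset.univ (fun i => ∑ j, ‖X i j‖ ^ 2)
    (fun j => Finset.sum_nonneg fun i _ => by positivity) ξ hξ
  refine ⟨z, hz, ?_⟩
  rw [Rop_apply, vecE_inner, vecE_norm_sq, ← h]
  refine Finset.sum_congr rfl fun i _ => ?_
  have := hq i
  simp only [norm_star] at this
  rw [← this]
  simp only [dotProduct, Matrix.mulVec, Matrix.mul_apply, Pi.star_apply, star_star, Finset.mul_sum]
  rw [Finset.sum_comm]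
  refine Finset.sum_congr rfl fun a _ => Finset.sum_congr rfl fun b _ => ?_
  ring

lemma block_bound {E : Set ℂ} (hEc : IsCompact E) (hE : Convex ℝ E) (hne : E.Nonempty)
    {M : Matrix (Fin k) (Fin k) ℂ} (hM : numRange M ⊆ E)
    {N : Matrix (Fin l) (Fin l) ℂ} (hN : numRange N ⊆ E)
    (D : Matrix (Fin k) (Fin l) ℂ) (g : Polynomial ℂ) (s : ℝ)
    (hs : ∀ z ∈ E, ‖(derivative g).eval z‖ ≤ s) :
    frobNorm (aeval (Matrix.fromBlocks M D 0 N) g).toBlocks₁₂ ≤ 4 * s * frobNorm D := by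
  rw [← vecE_norm, ← vecE_norm, block_int]
  refine (ContinuousLinearMap.le_opNorm _ _).trans ?_
  gcongr
  have : ‖∫ t in (0:ℝ)..1, aeval (seg (Lop l M) (Rop k N) t) (derivative g)‖ ≤
      4 * s * |1 - 0| := by
    apply intervalIntegral.norm_integral_le_of_norm_le_const
    intro t ht
    rw [Set.uIoc_of_le zero_le_one] at ht
    refine fc_bound hEc hE ?_ _ s hs
    intro x
    obtain ⟨ξ, hξ, h1⟩ := Lop_WIn (l := l) hE hne hM x
    obtain ⟨ζ, hζ, h2⟩ := Rop_WIn (k := k) hE hne hN x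
    refine ⟨_, hE hξ hζ ht.1.le (sub_nonneg.2 ht.2) (by ring), ?_⟩
    have e : seg (Lop l M) (Rop k N) t x = (t:ℂ) • Lop l M x + ((1 - t : ℝ) : ℂ) • Rop k N x := rfl
    rw [e, inner_add_right, inner_smul_right, inner_smul_right, h1, h2]
    simp only [Complex.real_smul]
    ring
  simpa using this

end MatrixPart

section Final

/-- the (1,2) block of powers of a block upper triangular matrix -/
noncomputable def blk {k l : ℕ} (M : Matrix (Fin k) (Fin k) ℂ) (D : Matrix (Fin k) (Fin l) ℂ)
    (N : Matrix (Fin l) (Fin l) ℂ) (j : ℕ) : Matrix (Fin k) (Fin l) ℂ :=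
  ∑ i ∈ Finset.range j, M ^ i * D * N ^ (j - 1 - i)

lemma blk_succ {k l : ℕ} (M : Matrix (Fin k) (Fin k) ℂ) (D : Matrix (Fin k) (Fin l) ℂ)
    (N : Matrix (Fin l) (Fin l) ℂ) (j : ℕ) : blk M D N (j + 1) = M ^ j * D + blk M D N j * N := by
  rw [blk, Finset.sum_range_succ, blk, Matrix.sum_mul, add_comm]
  congr 1
  · simp
  · refine Finset.sum_congr rfl fun i hi => ?_
    rw [Finset.mem_range] at hi
    rw [Matrix.mul_assoc (M ^ i * D), ← pow_succ]
    congr 2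
    omega

lemma fromBlocks_pow' {k l : ℕ} (M : Matrix (Fin k) (Fin k) ℂ) (D : Matrix (Fin k) (Fin l) ℂ)
    (N : Matrix (Fin l) (Fin l) ℂ) (j : ℕ) :
    (Matrix.fromBlocks M D 0 N) ^ j = Matrix.fromBlocks (M ^ j) (blk M D N j) 0 (N ^ j) := by
  induction j with
  | zero => simp [blk, Matrix.fromBlocks_one]
  | succ j ih =>
    rw [pow_succ, ih, Matrix.fromBlocks_multiply, blk_succ]
    simp [pow_succ]

/-- the (1,2) block as a linear map in the polynomial -/
noncomputable def b12 {k l : ℕ} (T : Matrix (Fin k ⊕ Fin l) (Fin k ⊕ Fin l) ℂ) :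
    Polynomial ℂ →ₗ[ℂ] Matrix (Fin k) (Fin l) ℂ where
  toFun g := (aeval T g).toBlocks₁₂
  map_add' p q := by rw [map_add]; rfl
  map_smul' c p := by rw [map_smul]; rfl

lemma b12_monomial {k l : ℕ} (M : Matrix (Fin k) (Fin k) ℂ) (D : Matrix (Fin k) (Fin l) ℂ)
    (N : Matrix (Fin l) (Fin l) ℂ) (j : ℕ) (a : ℂ) :
    b12 (Matrix.fromBlocks M D 0 N) (monomial j a) = a • blk M D N j := by
  change (aeval (Matrix.fromBlocks M D 0 N) (monomial j a)).toBlocks₁₂ = _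
  rw [aeval_monomial, ← Algebra.smul_def, fromBlocks_pow']
  ext i j; rfl

lemma blk_diff {n : ℕ} (A D : Matrix (Fin n) (Fin n) ℂ) (j : ℕ) :
    blk A D (A + D) j = (A + D) ^ j - A ^ j := by
  induction j with
  | zero => simp [blk]
  | succ j ih => rw [blk_succ, ih, pow_succ (A + D), pow_succ A]; noncomm_ring

lemma aeval_diff {n : ℕ} (A D : Matrix (Fin n) (Fin n) ℂ) (g : Polynomial ℂ) :
    aeval (A + D) g - aeval A g = b12 (Matrix.fromBlocks A D 0 (A + D)) g := by
  induction g using Polynomial.induction_on' with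
  | add p q hp hq => rw [map_add (b12 _), ← hp, ← hq, map_add, map_add]; abel
  | monomial j a =>
    rw [b12_monomial, blk_diff, aeval_monomial, aeval_monomial, ← Algebra.smul_def,
      ← Algebra.smul_def, smul_sub]

lemma frobNorm_sq {k l : ℕ} (X : Matrix (Fin k) (Fin l) ℂ) :
    frobNorm X ^ 2 = (Matrix.trace (Xᴴ * X)).re := by
  rw [← vecE_norm, vecE_norm_sq, Finset.sum_comm, Matrix.trace, Complex.re_sum]
  refine Finset.sum_congr rfl fun j _ => ?_
  rw [Matrix.diag_apply, Matrix.mul_apply, Complex.re_sum]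
  refine Finset.sum_congr rfl fun i _ => ?_
  rw [Matrix.conjTranspose_apply]
  have : star (X i j) * X i j = ((‖X i j‖ ^ 2 : ℝ) : ℂ) := by
    push_cast; exact Complex.conj_mul' (X i j)
  rw [this, Complex.ofReal_re]

lemma frobNorm_nonneg {k l : ℕ} (X : Matrix (Fin k) (Fin l) ℂ) : 0 ≤ frobNorm X :=
  Real.sqrt_nonneg _

lemma frobNorm_conjTranspose {k l : ℕ} (X : Matrix (Fin k) (Fin l) ℂ) :
    frobNorm Xᴴ = frobNorm X := by
  rw [frobNorm, frobNorm, Finset.sum_comm]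
  simp [Matrix.conjTranspose_apply]

lemma frobNorm_isometry {n k l : ℕ} (U : Matrix (Fin n) (Fin k) ℂ) (hU : Uᴴ * U = 1)
    (X : Matrix (Fin k) (Fin l) ℂ) : frobNorm (U * X) = frobNorm X := by
  have : frobNorm (U * X) ^ 2 = frobNorm X ^ 2 := by
    rw [frobNorm_sq, frobNorm_sq, Matrix.conjTranspose_mul, Matrix.mul_assoc, ← Matrix.mul_assoc Uᴴ,
      hU, Matrix.one_mul]
  exact (sq_eq_sq₀ (frobNorm_nonneg _) (frobNorm_nonneg _)).1 this

lemma frobNorm_contract {n k l : ℕ} (U : Matrix (Fin n) (Fin k) ℂ) (hU : Uᴴ * U = 1)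
    (Y : Matrix (Fin n) (Fin l) ℂ) : frobNorm (Uᴴ * Y) ≤ frobNorm Y := by
  apply le_of_sq_le_sq _ (frobNorm_nonneg _)
  have h := sq_nonneg (frobNorm (Y - U * (Uᴴ * Y)))
  have e : (Y - U * (Uᴴ * Y))ᴴ * (Y - U * (Uᴴ * Y)) = Yᴴ * Y - (Uᴴ * Y)ᴴ * (Uᴴ * Y) := by
    have e1 : (U * (Uᴴ * Y))ᴴ * (U * (Uᴴ * Y)) = (Uᴴ * Y)ᴴ * (Uᴴ * Y) := by
      rw [Matrix.conjTranspose_mul U, Matrix.mul_assoc, ← Matrix.mul_assoc Uᴴ U, hU, Matrix.one_mul]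
    have e2 : Yᴴ * (U * (Uᴴ * Y)) = (Uᴴ * Y)ᴴ * (Uᴴ * Y) := by
      rw [Matrix.conjTranspose_mul, Matrix.conjTranspose_conjTranspose, Matrix.mul_assoc]
    have e3 : (U * (Uᴴ * Y))ᴴ * Y = (Uᴴ * Y)ᴴ * (Uᴴ * Y) := by
      rw [Matrix.conjTranspose_mul U, Matrix.mul_assoc]
    rw [Matrix.conjTranspose_sub, Matrix.sub_mul, Matrix.mul_sub, Matrix.mul_sub, e1, e2, e3]
    abel
  rw [frobNorm_sq, e, Matrix.trace_sub, Complex.sub_re, ← frobNorm_sq, ← frobNorm_sq] at h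
  linarith

lemma frobNorm_sub_le {k l : ℕ} (X Y : Matrix (Fin k) (Fin l) ℂ) :
    frobNorm (X - Y) ≤ frobNorm X + frobNorm Y := by
  rw [← vecE_norm, ← vecE_norm, ← vecE_norm, map_sub]
  exact norm_sub_le _ _

lemma numRange_compress {n k : ℕ} (A : Matrix (Fin n) (Fin n) ℂ) (U : Matrix (Fin n) (Fin k) ℂ)
    (hU : Uᴴ * U = 1) : numRange (Uᴴ * A * U) ⊆ numRange A := by
  rintro z ⟨x, hx, rfl⟩
  refine ⟨U.mulVec x, ?_, ?_⟩
  · rw [Matrix.star_mulVec, ← Matrix.dotProduct_mulVec, Matrix.mulVec_mulVec, hU, Matrix.one_mulVec,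
      hx]
  · rw [Matrix.star_mulVec, ← Matrix.dotProduct_mulVec, Matrix.mulVec_mulVec, Matrix.mulVec_mulVec]

lemma proj_span {n k : ℕ} (U : Matrix (Fin n) (Fin k) ℂ) (hU : Uᴴ * U = 1) (v : Fin n → ℂ)
    (hv : v ∈ Submodule.span ℂ (Set.range Uᵀ)) : (U * Uᴴ).mulVec v = v := by
  induction hv using Submodule.span_induction with
  | mem x hx =>
    obtain ⟨j, rfl⟩ := hx
    have h1 : (U * Uᴴ) * U = U := by rw [Matrix.mul_assoc, hU, Matrix.mul_one]
    funext i
    have h2 := congrFun (congrFun h1 i) j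
    simpa [Matrix.mul_apply, Matrix.mulVec, dotProduct] using h2
  | zero => simp
  | add x y _ _ hx hy => rw [Matrix.mulVec_add, hx, hy]
  | smul a x _ hx => rw [Matrix.mulVec_smul, hx]

lemma proj_krylov {n k ℓ m : ℕ} (A : Matrix (Fin n) (Fin n) ℂ) (B : Matrix (Fin n) (Fin ℓ) ℂ)
    (U : Matrix (Fin n) (Fin k) ℂ) (hU : IsOrthonormalBasisOf U (Krylov m A B)) (i : ℕ)
    (hi : i < m) : U * Uᴴ * (A ^ i * B) = A ^ i * B := by
  ext a j
  have h1 : (A ^ i * B)ᵀ j ∈ Submodule.span ℂ (Set.range Uᵀ) := by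
    rw [hU.2]
    exact Submodule.subset_span ⟨i, hi, j, rfl⟩
  have h2 := congrFun (proj_span U hU.1 _ h1) a
  rw [Matrix.mul_apply]
  exact h2

lemma proj_pow {n k ℓ m : ℕ} (M : Matrix (Fin n) (Fin n) ℂ) (B : Matrix (Fin n) (Fin ℓ) ℂ)
    (U : Matrix (Fin n) (Fin k) ℂ) (h : ∀ i < m, U * Uᴴ * (M ^ i * B) = M ^ i * B) (i : ℕ)
    (hi : i < m) : U * ((Uᴴ * M * U) ^ i * (Uᴴ * B)) = M ^ i * B := by
  induction i with
  | zero =>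
    have := h 0 hi
    simpa [Matrix.mul_assoc] using this
  | succ i ih =>
    have h1 := ih (by omega)
    rw [pow_succ', Matrix.mul_assoc, Matrix.mul_assoc (Uᴴ * M), h1, Matrix.mul_assoc Uᴴ,
      ← Matrix.mul_assoc M, ← pow_succ', ← Matrix.mul_assoc U, h _ hi]

lemma proj_krylov_shift {n ℓ m : ℕ} (A : Matrix (Fin n) (Fin n) ℂ) (B C : Matrix (Fin n) (Fin ℓ) ℂ)
    (P : Matrix (Fin n) (Fin n) ℂ) (h : ∀ i < m, P * (A ^ i * C) = A ^ i * C) (j : ℕ) :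
    ∀ i, i + j < m → P * (A ^ i * ((A + C * Bᴴ) ^ j * C)) = A ^ i * ((A + C * Bᴴ) ^ j * C) := by
  induction j with
  | zero => intro i hi; simpa using h i (by omega)
  | succ j ih =>
    intro i hi
    have e : A ^ i * ((A + C * Bᴴ) ^ (j + 1) * C) = A ^ (i + 1) * ((A + C * Bᴴ) ^ j * C) +
        A ^ i * C * (Bᴴ * ((A + C * Bᴴ) ^ j * C)) := by
      rw [pow_succ', pow_succ]
      simp only [Matrix.add_mul, Matrix.mul_add, Matrix.mul_assoc]
    rw [e, Matrix.mul_add, ih (i + 1) (by omega), ← Matrix.mul_assoc P, h i (by omega)]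

lemma exact_blk {n ℓ m kU kV : ℕ} (A : Matrix (Fin n) (Fin n) ℂ)
    (B C : Matrix (Fin n) (Fin ℓ) ℂ)
    (U : Matrix (Fin n) (Fin kU) ℂ) (hU : IsOrthonormalBasisOf U (Krylov m A B))
    (V : Matrix (Fin n) (Fin kV) ℂ) (hV : IsOrthonormalBasisOf V (Krylov m Aᴴ C)) (j : ℕ)
    (hj : j ≤ m) :
    blk A (B * Cᴴ) (A + B * Cᴴ) j =
      U * blk (Uᴴ * A * U) (Uᴴ * (B * Cᴴ) * V) (Vᴴ * (A + B * Cᴴ) * V) j * Vᴴ := by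
  have h1 := fun i hi => proj_pow A B U (proj_krylov A B U hU) i hi
  have h2 : ∀ i < m, Cᴴ * V * (Vᴴ * (A + B * Cᴴ) * V) ^ i * Vᴴ = Cᴴ * (A + B * Cᴴ) ^ i := by
    intro i hi
    have e : (A + B * Cᴴ)ᴴ = Aᴴ + C * Bᴴ := by
      rw [Matrix.conjTranspose_add, Matrix.conjTranspose_mul, Matrix.conjTranspose_conjTranspose]
    have h3 := proj_pow (A + B * Cᴴ)ᴴ C V (by
      intro i hi
      have := proj_krylov_shift Aᴴ B C (V * Vᴴ) (proj_krylov Aᴴ C V hV) i 0 (by omega)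
      rw [e]
      simpa using this) i hi
    have h4 := congrArg Matrix.conjTranspose h3
    simp only [Matrix.conjTranspose_mul, Matrix.conjTranspose_pow,
      Matrix.conjTranspose_conjTranspose] at h4
    rw [← h4]
    simp only [Matrix.mul_assoc]
  rw [blk, blk, Matrix.mul_sum, Matrix.sum_mul]
  refine Finset.sum_congr rfl fun i hi => ?_
  rw [Finset.mem_range] at hi
  have a1 := h1 i (by omega)
  have a2 := h2 (j - 1 - i) (by omega)
  calc A ^ i * (B * Cᴴ) * (A + B * Cᴴ) ^ (j - 1 - i)
      = (A ^ i * B) * (Cᴴ * (A + B * Cᴴ) ^ (j - 1 - i)) := by simp only [Matrix.mul_assoc]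
    _ = _ := by
      rw [← a1, ← a2]; simp only [Matrix.mul_assoc]

lemma err_bound {n ℓ m kU kV : ℕ} (hn : 0 < n) (A : Matrix (Fin n) (Fin n) ℂ)
    (B C : Matrix (Fin n) (Fin ℓ) ℂ) (f : Polynomial ℂ) (E : Set ℂ)
    (hEcompact : IsCompact E) (hEconvex : Convex ℝ E)
    (hWA : numRange A ⊆ E) (hWAD : numRange (A + B * Cᴴ) ⊆ E)
    (U : Matrix (Fin n) (Fin kU) ℂ) (hU : IsOrthonormalBasisOf U (Krylov m A B))
    (V : Matrix (Fin n) (Fin kV) ℂ) (hV : IsOrthonormalBasisOf V (Krylov m Aᴴ C))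
    (p : Polynomial ℂ) (hp : p.degree < (m : ℕ)) (s : ℝ)
    (hs : ∀ z ∈ E, ‖(derivative f - p).eval z‖ ≤ s) :
    frobNorm (aeval (A + B * Cᴴ) f - aeval A f - U * b12 (Matrix.fromBlocks (Uᴴ * A * U)
      (Uᴴ * (B * Cᴴ) * V) 0 (Vᴴ * (A + B * Cᴴ) * V)) f * Vᴴ) ≤ 8 * s * frobNorm (B * Cᴴ) := by
  have hne : E.Nonempty := by
    refine ⟨_, hWA ⟨Pi.single ⟨0, hn⟩ 1, ?_, rfl⟩⟩
    simp [dotProduct, Pi.single_apply]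
  set T := Matrix.fromBlocks (Uᴴ * A * U) (Uᴴ * (B * Cᴴ) * V) 0 (Vᴴ * (A + B * Cᴴ) * V) with hT
  set T' := Matrix.fromBlocks A (B * Cᴴ) 0 (A + B * Cᴴ) with hT'
  set P : Polynomial ℂ := ∑ i ∈ Finset.range m, monomial (i + 1) (p.coeff i / ((i:ℂ) + 1)) with hP
  have hPd : derivative P = p := by
    rw [hP, derivative_sum]
    ext j
    rw [finset_sum_coeff]
    have : ∀ i ∈ Finset.range m, (derivative (monomial (i + 1) (p.coeff i / ((i:ℂ) + 1)))).coeff j =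
        if i = j then p.coeff j else 0 := by
      intro i _
      rw [derivative_monomial, Nat.add_sub_cancel, coeff_monomial]
      have : (i:ℂ) + 1 ≠ 0 := by exact_mod_cast Nat.succ_ne_zero i
      split_ifs with h
      · subst h; push_cast; field_simp
      · rfl
    rw [Finset.sum_congr rfl this, Finset.sum_ite_eq']
    split_ifs with h
    · rfl
    · rw [Finset.mem_range, not_lt] at h
      exact (coeff_eq_zero_of_degree_lt (hp.trans_le (by exact_mod_cast h))).symm
  have hPe : b12 T' P = U * b12 T P * Vᴴ := by
    rw [hP, map_sum, map_sum, Matrix.mul_sum, Matrix.sum_mul]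
    refine Finset.sum_congr rfl fun i hi => ?_
    rw [Finset.mem_range] at hi
    rw [hT, hT', b12_monomial, b12_monomial, exact_blk A B C U hU V hV (i + 1) (by omega)]
    simp
  set g := f - P with hg
  have hfg : f = g + P := by rw [hg]; ring
  have hgd : derivative g = derivative f - p := by rw [hg, derivative_sub, hPd]
  rw [aeval_diff, ← hT']
  have e : b12 T' f - U * b12 T f * Vᴴ = b12 T' g - U * b12 T g * Vᴴ := by
    rw [hfg, map_add, map_add, hPe, Matrix.mul_add, Matrix.add_mul]; abel
  rw [e]
  have b1 : frobNorm (b12 T' g) ≤ 4 * s * frobNorm (B * Cᴴ) :=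
    block_bound hEcompact hEconvex hne hWA hWAD _ g s (by rw [hgd]; exact hs)
  have b2 : frobNorm (b12 T g) ≤ 4 * s * frobNorm (Uᴴ * (B * Cᴴ) * V) :=
    block_bound hEcompact hEconvex hne ((numRange_compress A U hU.1).trans hWA)
      ((numRange_compress _ V hV.1).trans hWAD) _ g s (by rw [hgd]; exact hs)
  have b3 : frobNorm (U * b12 T g * Vᴴ) = frobNorm (b12 T g) := by
    rw [Matrix.mul_assoc, frobNorm_isometry U hU.1, ← frobNorm_conjTranspose,
      Matrix.conjTranspose_mul, Matrix.conjTranspose_conjTranspose, frobNorm_isometry V hV.1,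
      frobNorm_conjTranspose]
  have b4 : frobNorm (Uᴴ * (B * Cᴴ) * V) ≤ frobNorm (B * Cᴴ) := by
    rw [Matrix.mul_assoc]
    refine (frobNorm_contract U hU.1 _).trans ?_
    rw [← frobNorm_conjTranspose, Matrix.conjTranspose_mul]
    refine (frobNorm_contract V hV.1 _).trans ?_
    rw [frobNorm_conjTranspose]
  obtain ⟨ξ, hξ⟩ := hne
  have hs0 : 0 ≤ s := (norm_nonneg _).trans (hs ξ hξ)
  have b5 : 4 * s * frobNorm (Uᴴ * (B * Cᴴ) * V) ≤ 4 * s * frobNorm (B * Cᴴ) := by gcongr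
  have := frobNorm_sub_le (b12 T' g) (U * b12 T g * Vᴴ)
  rw [b3] at this
  linarith

end Final

/-- convergence bound for the polynomial Krylov update (Theorem 4.4 of the
paper, for polynomial `f`): the error of the Krylov update approximation is bounded by
`2(1+√2)² ‖BCᴴ‖_F inf_{p ∈ Π_{m-1}} sup_{z ∈ E} |f'(z) - p(z)|`. -/
theorem stmt11 (n ℓ m kU kV : ℕ) (A : Matrix (Fin n) (Fin n) ℂ)
    (B C : Matrix (Fin n) (Fin ℓ) ℂ) (f : Polynomial ℂ) (E : Set ℂ)
    (hEcompact : IsCompact E) (hEconvex : Convex ℝ E)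
    (hWA : numRange A ⊆ E) (hWAD : numRange (A + B * Cᴴ) ⊆ E)
    (U : Matrix (Fin n) (Fin kU) ℂ) (hU : IsOrthonormalBasisOf U (Krylov m A B))
    (V : Matrix (Fin n) (Fin kV) ℂ) (hV : IsOrthonormalBasisOf V (Krylov m Aᴴ C))
    (G : Matrix (Fin kU) (Fin kU) ℂ) (hG : G = Uᴴ * A * U)
    (H : Matrix (Fin kV) (Fin kV) ℂ) (hH : H = Vᴴ * Aᴴ * V)
    (T : Matrix (Fin kU ⊕ Fin kV) (Fin kU ⊕ Fin kV) ℂ)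
    (hT : T = Matrix.fromBlocks G ((Uᴴ * B) * (Vᴴ * C)ᴴ) 0 (Hᴴ + (Vᴴ * B) * (Vᴴ * C)ᴴ))
    (Xm : Matrix (Fin kU) (Fin kV) ℂ) (hXm : Xm = (aeval T f).toBlocks₁₂) :
    frobNorm (aeval (A + B * Cᴴ) f - aeval A f - U * Xm * Vᴴ) ≤
      2 * (1 + Real.sqrt 2) ^ 2 * frobNorm (B * Cᴴ) *
        sInf {t : ℝ | ∃ p : Polynomial ℂ, p.degree < (m : ℕ) ∧
          t = sSup ((fun z => ‖(Polynomial.derivative f - p).eval z‖) '' E)} := by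
  rcases Nat.eq_zero_or_pos n with hn | hn
  · subst hn
    simp [frobNorm]
  have hTe : T = Matrix.fromBlocks (Uᴴ * A * U) (Uᴴ * (B * Cᴴ) * V) 0
      (Vᴴ * (A + B * Cᴴ) * V) := by
    rw [hT, hG, hH]
    simp only [Matrix.conjTranspose_mul, Matrix.conjTranspose_conjTranspose, Matrix.mul_assoc,
      Matrix.mul_add, Matrix.add_mul]
  have hXe : Xm = b12 T f := hXm
  rw [hXe, hTe]
  have key := fun p hp s hs => err_bound hn A B C f E hEcompact hEconvex hWA hWAD U hU V hV p hp s hs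
  set LHS := frobNorm (aeval (A + B * Cᴴ) f - aeval A f - U * b12 (Matrix.fromBlocks (Uᴴ * A * U)
      (Uᴴ * (B * Cᴴ) * V) 0 (Vᴴ * (A + B * Cᴴ) * V)) f * Vᴴ) with hLHS
  set S : Set ℝ := {t : ℝ | ∃ p : Polynomial ℂ, p.degree < (m : ℕ) ∧
          t = sSup ((fun z => ‖(Polynomial.derivative f - p).eval z‖) '' E)} with hS
  have hd0 := frobNorm_nonneg (B * Cᴴ)
  have hall : ∀ t ∈ S, 0 ≤ t ∧ LHS ≤ 8 * t * frobNorm (B * Cᴴ) := by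
    rintro t ⟨p, hp, rfl⟩
    refine ⟨Real.sSup_nonneg ?_, key p hp _ fun z hz => ?_⟩
    · rintro _ ⟨z, _, rfl⟩; exact norm_nonneg _
    · refine le_csSup ?_ ⟨z, hz, rfl⟩
      exact (hEcompact.image ((Polynomial.derivative f - p).continuous.norm)).bddAbove
  have hSne : S.Nonempty := ⟨_, 0, by simpa using WithBot.bot_lt_coe m, rfl⟩
  have hconst : (8:ℝ) ≤ 2 * (1 + Real.sqrt 2) ^ 2 := by
    have : (1:ℝ) ≤ Real.sqrt 2 := Real.one_le_sqrt.2 (by norm_num)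
    nlinarith
  rcases hd0.eq_or_lt with h0 | h0
  · obtain ⟨t, ht⟩ := hSne
    have := (hall t ht).2
    rw [← h0] at this ⊢
    simpa using this
  · have h1 : LHS / (8 * frobNorm (B * Cᴴ)) ≤ sInf S := by
      refine le_csInf hSne fun t ht => ?_
      rw [div_le_iff₀ (by positivity)]
      have := (hall t ht).2
      linarith
    have h2 : 0 ≤ sInf S := Real.sInf_nonneg fun t ht => (hall t ht).1
    rw [div_le_iff₀ (by positivity)] at h1
    calc LHS ≤ sInf S * (8 * frobNorm (B * Cᴴ)) := h1
      _ = 8 * frobNorm (B * Cᴴ) * sInf S := by ring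
      _ ≤ _ := by gcongr
end

section
/- Let A ∈ ℂ^{n×n} be Hermitian, B ∈ ℂ^{n×ℓ}, J ∈ ℂ^{ℓ×ℓ} Hermitian, and D = BJB*. Let ξ_1,…,ξ_m be real poles (not eigenvalues of A) and q_m(z) = (z−ξ_1)⋯(z−ξ_m), and let U be an orthonormal basis of the rational Krylov subspace q_m(A)^{−1}K_m(A,B). Let [a,b] ⊂ ℝ be a compact interval containing all eigenvalues of A and of A+D, and assume q_m has no zero in [a,b]. Then for every continuous function f : ℝ → ℝ, ‖f(A+D) − f(A) − U ( f(U*(A+D)U) − f(U*AU) ) U*‖ ≤ 4 · inf_{p ∈ Π_m, p real} sup_{x∈[a,b]} |f(x) − p(x)/q_m(x)|, where f is applied to the Hermitian matrices A, A+D, U*AU, U*(A+D)U via the Hermitian functional calculus, ‖·‖ is the spectral norm, and the infimum is over all real polynomials p of degree at most m. -/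
open Polynomial Matrix

/-- The spectral norm (operator 2-norm) of a complex matrix:
`sup { ‖Mx‖₂ : ‖x‖₂ ≤ 1 }`. -/
noncomputable def specNorm {k l : ℕ} (M : Matrix (Fin k) (Fin l) ℂ) : ℝ :=
  sSup {r | ∃ x : Fin l → ℂ, (star x ⬝ᵥ x).re ≤ 1 ∧
    r = Real.sqrt ((star (M.mulVec x) ⬝ᵥ M.mulVec x).re)}

namespace RK

/-- The span of the products `X^i (X - Y) Y^j` with `i, j < m`. -/
def bezSpan {R : Type*} [Ring R] [Algebra ℝ R] (X Y : R) (m : ℕ) : Submodule ℝ R :=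
  Submodule.span ℝ {T : R | ∃ i < m, ∃ j < m, T = X ^ i * (X - Y) * Y ^ j}

lemma bez_mono {R : Type*} [Ring R] [Algebra ℝ R] (X Y : R) (m s t d : ℕ) (h : s + d ≤ m)
    (h' : t + d ≤ m) :
    X ^ s * Y ^ (t + d) - X ^ (s + d) * Y ^ t ∈ bezSpan X Y m := by
  induction d generalizing t with
  | zero => simp
  | succ d ih =>
    have e : X ^ s * Y ^ (t + (d + 1)) - X ^ (s + (d + 1)) * Y ^ t
        = (X ^ s * Y ^ (t + 1 + d) - X ^ (s + d) * Y ^ (t + 1))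
          - X ^ (s + d) * (X - Y) * Y ^ t := by
      have e1 : s + (d + 1) = (s + d) + 1 := by omega
      have e2 : t + (d + 1) = t + 1 + d := by omega
      rw [e1, e2, pow_succ X (s + d), pow_succ' Y t]
      simp only [sub_mul, mul_sub, mul_assoc]
      abel
    rw [e]
    refine Submodule.sub_mem _ (ih _ (by omega) (by omega)) (Submodule.subset_span ?_)
    exact ⟨s + d, by omega, t, by omega, rfl⟩

lemma bez {R : Type*} [Ring R] [Algebra ℝ R] (X Y : R) (m : ℕ) (p q : ℝ[X])
    (hp : p.natDegree ≤ m) (hq : q.natDegree ≤ m) :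
    aeval X p * aeval Y q - aeval X q * aeval Y p ∈ bezSpan X Y m := by
  rw [aeval_eq_sum_range' (Nat.lt_succ_of_le hp), aeval_eq_sum_range' (Nat.lt_succ_of_le hq),
    aeval_eq_sum_range' (Nat.lt_succ_of_le hp), aeval_eq_sum_range' (Nat.lt_succ_of_le hq),
    Finset.sum_mul_sum, Finset.sum_mul_sum, Finset.sum_comm, ← Finset.sum_sub_distrib]
  refine Submodule.sum_mem _ fun t ht => ?_
  rw [← Finset.sum_sub_distrib]
  refine Submodule.sum_mem _ fun s hs => ?_
  have ht := Finset.mem_range.1 ht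
  have hs := Finset.mem_range.1 hs
  have e : p.coeff s • X ^ s * q.coeff t • Y ^ t - q.coeff t • X ^ t * p.coeff s • Y ^ s
      = (p.coeff s * q.coeff t) • (X ^ s * Y ^ t - X ^ t * Y ^ s) := by
    simp only [smul_mul_smul_comm, smul_sub]
    rw [mul_comm (q.coeff t)]
  rw [e]
  refine Submodule.smul_mem _ _ ?_
  rcases le_total s t with h | h
  · obtain ⟨d, rfl⟩ := Nat.exists_eq_add_of_le h
    exact bez_mono X Y m s s d (by omega) (by omega)
  · obtain ⟨d, rfl⟩ := Nat.exists_eq_add_of_le h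
    rw [← neg_sub]
    exact Submodule.neg_mem _ (bez_mono X Y m t t d (by omega) (by omega))

lemma comm_inv {n : ℕ} (M : Matrix (Fin n) (Fin n) ℂ) (p q : ℝ[X]) :
    aeval M p * (aeval M q)⁻¹ = (aeval M q)⁻¹ * aeval M p := by
  by_cases h : IsUnit (aeval M q)
  · have hd := (Matrix.isUnit_iff_isUnit_det _).1 h
    have hc : aeval M p * aeval M q = aeval M q * aeval M p := by
      rw [← map_mul, ← map_mul, mul_comm]
    calc aeval M p * (aeval M q)⁻¹
        = (aeval M q)⁻¹ * (aeval M q * aeval M p) * (aeval M q)⁻¹ := by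
          rw [← Matrix.mul_assoc, Matrix.nonsing_inv_mul _ hd, Matrix.one_mul]
      _ = (aeval M q)⁻¹ * aeval M p := by
          rw [← hc, Matrix.mul_assoc, Matrix.mul_assoc, Matrix.mul_nonsing_inv _ hd,
            Matrix.mul_one]
  · have hd : ¬ IsUnit (aeval M q).det := fun h' => h ((Matrix.isUnit_iff_isUnit_det _).2 h')
    rw [Matrix.nonsing_inv_apply_not_isUnit _ hd]; simp

lemma pow_comm_inv {n : ℕ} (M : Matrix (Fin n) (Fin n) ℂ) (i : ℕ) (q : ℝ[X]) :
    M ^ i * (aeval M q)⁻¹ = (aeval M q)⁻¹ * M ^ i := by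
  have := comm_inv M (X ^ i) q
  simpa using this

/-- Exactness of the compression on rational Krylov vectors. -/
lemma compress_exact {n k ℓ m : ℕ} (M : Matrix (Fin n) (Fin n) ℂ) (B : Matrix (Fin n) (Fin ℓ) ℂ)
    (U : Matrix (Fin n) (Fin k) ℂ) (q : ℝ[X]) (hq : q.natDegree ≤ m)
    (h1 : IsUnit (aeval M q)) (h2 : IsUnit (aeval (Uᴴ * M * U) q))
    (hS : ∀ j < m, U * (Uᴴ * ((aeval M q)⁻¹ * (M ^ j * B))) = (aeval M q)⁻¹ * (M ^ j * B))
    (j : ℕ) (hj : j < m) :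
    (aeval M q)⁻¹ * (M ^ j * B) =
      U * ((aeval (Uᴴ * M * U) q)⁻¹ * ((Uᴴ * M * U) ^ j * (Uᴴ * B))) := by
  set N := Uᴴ * M * U with hN
  set W := (aeval M q)⁻¹ * B with hW
  have hd1 := (Matrix.isUnit_iff_isUnit_det _).1 h1
  have hd2 := (Matrix.isUnit_iff_isUnit_det _).1 h2
  have hMW : ∀ i, (aeval M q)⁻¹ * (M ^ i * B) = M ^ i * W := by
    intro i
    rw [hW, ← Matrix.mul_assoc, ← pow_comm_inv, Matrix.mul_assoc]
  have key : ∀ i ≤ m, N ^ i * (Uᴴ * W) = Uᴴ * (M ^ i * W) := by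
    intro i
    induction i with
    | zero => simp
    | succ i ih =>
      intro hi
      have := hS i (by omega)
      rw [hMW] at this
      rw [pow_succ', Matrix.mul_assoc, ih (by omega), hN, Matrix.mul_assoc, this, pow_succ']
      simp only [Matrix.mul_assoc]
  have hqW : aeval N q * (Uᴴ * W) = Uᴴ * B := by
    have e : aeval N q * (Uᴴ * W) = Uᴴ * (aeval M q * W) := by
      rw [aeval_eq_sum_range' (Nat.lt_succ_of_le hq), aeval_eq_sum_range' (Nat.lt_succ_of_le hq),
        Matrix.sum_mul, Matrix.sum_mul, Matrix.mul_sum]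
      refine Finset.sum_congr rfl fun i hi => ?_
      rw [Matrix.smul_mul, Matrix.smul_mul, Matrix.mul_smul,
        key i (Nat.lt_succ_iff.1 (Finset.mem_range.1 hi))]
    rw [e, hW, ← Matrix.mul_assoc (aeval M q), Matrix.mul_nonsing_inv _ hd1, Matrix.one_mul]
  have hUW : (aeval N q)⁻¹ * (Uᴴ * B) = Uᴴ * W := by
    rw [← hqW, ← Matrix.mul_assoc, Matrix.nonsing_inv_mul _ hd2, Matrix.one_mul]
  rw [← Matrix.mul_assoc _ (N ^ j), ← pow_comm_inv, Matrix.mul_assoc, hUW, key j hj.le, ← hMW,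
    hS j hj]

lemma herm_aeval {n : ℕ} {M : Matrix (Fin n) (Fin n) ℂ} (hM : M.IsHermitian) (q : ℝ[X]) :
    (aeval M q)ᴴ = aeval M q := by
  rw [aeval_eq_sum_range, Matrix.conjTranspose_sum]
  refine Finset.sum_congr rfl fun i _ => ?_
  rw [Matrix.conjTranspose_smul, Matrix.conjTranspose_pow, hM.eq]
  simp

lemma gen_span {n k ℓ m : ℕ} (A C QA QC : Matrix (Fin n) (Fin n) ℂ)
    (AU CU QAU QCU : Matrix (Fin k) (Fin k) ℂ)
    (B : Matrix (Fin n) (Fin ℓ) ℂ) (J : Matrix (Fin ℓ) (Fin ℓ) ℂ) (U : Matrix (Fin n) (Fin k) ℂ)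
    (e1 : C - A = B * J * Bᴴ) (e2 : CU - AU = Uᴴ * B * J * (Bᴴ * U))
    (e3 : ∀ j < m, Bᴴ * A ^ j * QA = Bᴴ * U * AU ^ j * QAU * Uᴴ)
    (e4 : ∀ i < m, QC * (C ^ i * B) = U * (QCU * (CU ^ i * (Uᴴ * B))))
    (T : Matrix (Fin n) (Fin n) ℂ × Matrix (Fin k) (Fin k) ℂ)
    (hT : T ∈ bezSpan (R := Matrix (Fin n) (Fin n) ℂ × Matrix (Fin k) (Fin k) ℂ)
      (C, CU) (A, AU) m) :
    QC * T.1 * QA = U * (QCU * T.2 * QAU) * Uᴴ := by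
  unfold bezSpan at hT
  induction hT using Submodule.span_induction with
  | mem T hT =>
    obtain ⟨i, hi, j, hj, rfl⟩ := hT
    simp only [Prod.fst_mul, Prod.snd_mul, Prod.pow_fst, Prod.pow_snd, Prod.fst_sub,
      Prod.snd_sub, e1, e2]
    calc _ = (QC * (C ^ i * B)) * J * (Bᴴ * A ^ j * QA) := by
          simp only [Matrix.mul_assoc]
      _ = _ := by
          rw [e4 i hi, e3 j hj]
          simp only [Matrix.mul_assoc]
  | zero => simp
  | add S T _ _ hS hT =>
    simp only [Prod.fst_add, Prod.snd_add, Matrix.mul_add, Matrix.add_mul, hS, hT]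
  | smul c T _ hT =>
    simp only [Prod.smul_fst, Prod.smul_snd, Matrix.mul_smul, Matrix.smul_mul, hT]

lemma hdiff {N : ℕ} (X Y : Matrix (Fin N) (Fin N) ℂ) (p q : ℝ[X]) (hX : IsUnit (aeval X q))
    (hY : IsUnit (aeval Y q)) : aeval X p * (aeval X q)⁻¹ - aeval Y p * (aeval Y q)⁻¹
        = (aeval X q)⁻¹ * (aeval X p * aeval Y q - aeval X q * aeval Y p) * (aeval Y q)⁻¹ := by
  have hX' := (Matrix.isUnit_iff_isUnit_det _).1 hX
  have hY' := (Matrix.isUnit_iff_isUnit_det _).1 hY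
  rw [Matrix.mul_sub, Matrix.sub_mul, ← Matrix.mul_assoc, ← Matrix.mul_assoc,
    Matrix.nonsing_inv_mul _ hX', Matrix.one_mul, Matrix.mul_assoc _ (aeval Y q),
    Matrix.mul_nonsing_inv _ hY', Matrix.mul_one, comm_inv X]

lemma bez_pair {n k m : ℕ} (A C : Matrix (Fin n) (Fin n) ℂ) (AU CU : Matrix (Fin k) (Fin k) ℂ)
    (p q : ℝ[X]) (hp : p.natDegree ≤ m) (hq : q.natDegree ≤ m) :
    (aeval C p * aeval A q - aeval C q * aeval A p,
      aeval CU p * aeval AU q - aeval CU q * aeval AU p) ∈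
    bezSpan (R := Matrix (Fin n) (Fin n) ℂ × Matrix (Fin k) (Fin k) ℂ) (C, CU) (A, AU) m := by
  have hb := bez (R := Matrix (Fin n) (Fin n) ℂ × Matrix (Fin k) (Fin k) ℂ) (C, CU) (A, AU) m p q
    hp hq
  rw [aeval_prod_apply, aeval_prod_apply, aeval_prod_apply, aeval_prod_apply] at hb
  exact hb

lemma quot {n k ℓ m : ℕ} (A : Matrix (Fin n) (Fin n) ℂ) (hA : A.IsHermitian)
    (B : Matrix (Fin n) (Fin ℓ) ℂ) (J : Matrix (Fin ℓ) (Fin ℓ) ℂ)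
    (C : Matrix (Fin n) (Fin n) ℂ) (hC : C = A + B * J * Bᴴ)
    (U : Matrix (Fin n) (Fin k) ℂ) (p q : ℝ[X]) (hp : p.natDegree ≤ m) (hq : q.natDegree ≤ m)
    (h1 : IsUnit (aeval A q)) (h2 : IsUnit (aeval (Uᴴ * A * U) q))
    (h3 : IsUnit (aeval C q)) (h4 : IsUnit (aeval (Uᴴ * C * U) q))
    (hSA : ∀ j < m, U * (Uᴴ * ((aeval A q)⁻¹ * (A ^ j * B))) = (aeval A q)⁻¹ * (A ^ j * B))
    (hSC : ∀ j < m, U * (Uᴴ * ((aeval C q)⁻¹ * (C ^ j * B))) = (aeval C q)⁻¹ * (C ^ j * B)) :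
    aeval C p * (aeval C q)⁻¹ - aeval A p * (aeval A q)⁻¹ =
      U * (aeval (Uᴴ * C * U) p * (aeval (Uᴴ * C * U) q)⁻¹
        - aeval (Uᴴ * A * U) p * (aeval (Uᴴ * A * U) q)⁻¹) * Uᴴ := by
  have eA := compress_exact A B U q hq h1 h2 hSA
  have eC := compress_exact C B U q hq h3 h4 hSC
  have hAU : (Uᴴ * A * U).IsHermitian := isHermitian_conjTranspose_mul_mul U hA
  have e1 : C - A = B * J * Bᴴ := by rw [hC]; abel
  have e2 : Uᴴ * C * U - Uᴴ * A * U = Uᴴ * B * J * (Bᴴ * U) := by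
    rw [← Matrix.sub_mul, ← Matrix.mul_sub, e1]
    simp only [Matrix.mul_assoc]
  have e3 : ∀ j < m, Bᴴ * A ^ j * (aeval A q)⁻¹ =
      Bᴴ * U * (Uᴴ * A * U) ^ j * (aeval (Uᴴ * A * U) q)⁻¹ * Uᴴ := by
    intro j hj
    have e := congrArg Matrix.conjTranspose (eA j hj)
    rw [Matrix.conjTranspose_mul, Matrix.conjTranspose_mul, Matrix.conjTranspose_mul U,
      Matrix.conjTranspose_mul _ ((Uᴴ * A * U) ^ j * (Uᴴ * B)),
      Matrix.conjTranspose_mul _ (Uᴴ * B), Matrix.conjTranspose_mul _ B,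
      Matrix.conjTranspose_nonsing_inv, Matrix.conjTranspose_nonsing_inv, herm_aeval hA,
      herm_aeval hAU, Matrix.conjTranspose_pow, Matrix.conjTranspose_pow, hA.eq, hAU.eq,
      Matrix.conjTranspose_conjTranspose] at e
    exact e
  rw [hdiff C A p q h3 h1, hdiff (Uᴴ * C * U) (Uᴴ * A * U) p q h4 h2]
  have h := gen_span A C (aeval A q)⁻¹ (aeval C q)⁻¹ (Uᴴ * A * U) (Uᴴ * C * U)
    (aeval (Uᴴ * A * U) q)⁻¹ (aeval (Uᴴ * C * U) q)⁻¹ B J U e1 e2 e3 eC _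
    (bez_pair A C (Uᴴ * A * U) (Uᴴ * C * U) p q hp hq)
  exact h

lemma proj {n k : ℕ} {U : Matrix (Fin n) (Fin k) ℂ} {S : Submodule ℂ (Fin n → ℂ)}
    (hU : IsOrthonormalBasisOf U S) {ℓ : ℕ} (V : Matrix (Fin n) (Fin ℓ) ℂ)
    (hV : ∀ j, V.col j ∈ S) : U * (Uᴴ * V) = V := by
  obtain ⟨h1, h2⟩ := hU
  have h3 : ∀ j, ∃ y, U *ᵥ y = V.col j := by
    intro j
    have := hV j
    rw [← h2] at this
    change _ ∈ Submodule.span ℂ (Set.range U.col) at this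
    rw [← Matrix.range_mulVecLin] at this
    exact this
  choose Y hY using h3
  have : V = U * (Matrix.of Y)ᵀ := by
    ext i j
    have := congrFun (hY j) i
    simpa [Matrix.mul_apply, Matrix.mulVec, dotProduct, Matrix.col] using this.symm
  rw [this, ← Matrix.mul_assoc Uᴴ, h1, Matrix.one_mul]

lemma mem_map {n : ℕ} (T : Matrix (Fin n) (Fin n) ℂ) (K : Submodule ℂ (Fin n → ℂ)) {ℓ : ℕ}
    (V : Matrix (Fin n) (Fin ℓ) ℂ) (hV : ∀ j, V.col j ∈ K) (j : Fin ℓ) :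
    (T * V).col j ∈ K.map T.mulVecLin := by
  refine ⟨V.col j, hV j, ?_⟩
  ext i
  simp [Matrix.mul_apply, Matrix.mulVec, dotProduct, Matrix.col]

lemma mul_col {n r s : ℕ} (K : Submodule ℂ (Fin n → ℂ))
    (V : Matrix (Fin n) (Fin r) ℂ) (hV : ∀ j, V.col j ∈ K) (Z : Matrix (Fin r) (Fin s) ℂ)
    (j : Fin s) : (V * Z).col j ∈ K := by
  have : (V * Z).col j = ∑ i, Z i j • V.col i := by
    ext i
    simp [Matrix.mul_apply, Matrix.col, Finset.sum_apply, mul_comm]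
  rw [this]
  exact Submodule.sum_mem _ fun i _ => Submodule.smul_mem _ _ (hV i)

lemma krylov_col {n ℓ m : ℕ} (A : Matrix (Fin n) (Fin n) ℂ) (B : Matrix (Fin n) (Fin ℓ) ℂ)
    (i : ℕ) (hi : i < m) (j : Fin ℓ) : (A ^ i * B).col j ∈ Krylov m A B :=
  Submodule.subset_span ⟨i, hi, j, rfl⟩

/-- Rational Krylov vectors of `C = A + B J Bᴴ` lie in the rational Krylov space of `A`. -/
lemma memC {n ℓ m : ℕ} (A : Matrix (Fin n) (Fin n) ℂ)
    (B : Matrix (Fin n) (Fin ℓ) ℂ) (J : Matrix (Fin ℓ) (Fin ℓ) ℂ)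
    (C : Matrix (Fin n) (Fin n) ℂ) (hC : C = A + B * J * Bᴴ)
    (q : ℝ[X]) (hq : q.natDegree ≤ m)
    (h1 : IsUnit (aeval A q)) (h3 : IsUnit (aeval C q)) (j : ℕ) (hj : j < m) (l : Fin ℓ) :
    ((aeval C q)⁻¹ * (C ^ j * B)).col l ∈
      (Krylov m A B).map ((aeval A q)⁻¹).mulVecLin := by
  have hA' := (Matrix.isUnit_iff_isUnit_det _).1 h1
  have hC' := (Matrix.isUnit_iff_isUnit_det _).1 h3
  have hb := bez A C m (X ^ j) q (by simpa using hj.le) hq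
  simp only [map_pow, aeval_X] at hb
  have gen : ∀ T ∈ bezSpan A C m, ∀ {s : ℕ} (Z : Matrix (Fin n) (Fin s) ℂ) (l : Fin s),
      (T * Z).col l ∈ Krylov m A B := by
    intro T hT
    induction hT using Submodule.span_induction with
    | mem T hT =>
      obtain ⟨i, hi, j, hj, rfl⟩ := hT
      intro s Z l
      have e : A ^ i * (A - C) * C ^ j * Z = (A ^ i * B) * (-(J * Bᴴ * C ^ j * Z)) := by
        rw [hC, sub_add_cancel_left]
        simp only [Matrix.mul_assoc, Matrix.mul_neg, Matrix.neg_mul]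
      rw [e]
      exact mul_col _ _ (krylov_col A B i hi) _ _
    | zero => intro s Z l; rw [Matrix.zero_mul]; exact Submodule.zero_mem _
    | add S T _ _ hS hT =>
      intro s Z l
      rw [Matrix.add_mul]
      exact Submodule.add_mem _ (hS Z l) (hT Z l)
    | smul c T _ hT =>
      intro s Z l
      have e : c • T * Z = T * (c • Z) := by rw [Matrix.smul_mul, Matrix.mul_smul]
      rw [e]
      exact hT _ l
  have e : (aeval C q)⁻¹ * (C ^ j * B) = (aeval A q)⁻¹ * (A ^ j * B -
      (A ^ j * aeval C q - aeval A q * C ^ j) * ((aeval C q)⁻¹ * B)) := by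
    rw [Matrix.sub_mul, Matrix.mul_assoc _ (aeval C q), ← Matrix.mul_assoc (aeval C q),
      Matrix.mul_nonsing_inv _ hC', Matrix.one_mul, sub_sub_cancel, Matrix.mul_assoc (aeval A q),
      ← Matrix.mul_assoc _ (aeval A q), Matrix.nonsing_inv_mul _ hA', Matrix.one_mul, ← Matrix.mul_assoc,
      ← Matrix.mul_assoc, pow_comm_inv]
  rw [e]
  refine mem_map _ _ _ (fun l => ?_) l
  exact Submodule.sub_mem _ (krylov_col A B j hj l) (gen _ hb _ l)

section analysis

open scoped MatrixOrder ComplexOrder in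
lemma spec_compress {n k : ℕ} {M : Matrix (Fin n) (Fin n) ℂ} (hM : M.IsHermitian)
    {U : Matrix (Fin n) (Fin k) ℂ} (hU : Uᴴ * U = 1) {a b : ℝ}
    (h : spectrum ℝ M ⊆ Set.Icc a b) : spectrum ℝ (Uᴴ * M * U) ⊆ Set.Icc a b := by
  have hMU : (Uᴴ * M * U).IsHermitian := isHermitian_conjTranspose_mul_mul U hM
  have hs : IsSelfAdjoint M := hM
  have hs' : IsSelfAdjoint (Uᴴ * M * U) := hMU
  have key : ∀ c : ℝ, Uᴴ * (algebraMap ℝ (Matrix (Fin n) (Fin n) ℂ) c) * U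
      = algebraMap ℝ (Matrix (Fin k) (Fin k) ℂ) c := by
    intro c
    rw [Algebra.algebraMap_eq_smul_one, Algebra.algebraMap_eq_smul_one, Matrix.mul_smul,
      Matrix.smul_mul, Matrix.mul_one, hU]
  have ha : algebraMap ℝ _ a ≤ M := (algebraMap_le_iff_le_spectrum hs).2 fun x hx => (h hx).1
  have hb : M ≤ algebraMap ℝ _ b := (le_algebraMap_iff_spectrum_le hs).2 fun x hx => (h hx).2
  have ha' : algebraMap ℝ _ a ≤ Uᴴ * M * U := by
    rw [Matrix.le_iff] at ha ⊢
    have := ha.conjTranspose_mul_mul_same U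
    rwa [Matrix.mul_sub, Matrix.sub_mul, key] at this
  have hb' : Uᴴ * M * U ≤ algebraMap ℝ _ b := by
    rw [Matrix.le_iff] at hb ⊢
    have := hb.conjTranspose_mul_mul_same U
    rwa [Matrix.mul_sub, Matrix.sub_mul, key] at this
  exact fun x hx => ⟨(algebraMap_le_iff_le_spectrum hs').1 ha' x hx,
    (le_algebraMap_iff_spectrum_le hs').1 hb' x hx⟩

lemma unit_aeval {n : ℕ} {M : Matrix (Fin n) (Fin n) ℂ} (hM : M.IsHermitian) (q : ℝ[X])
    (h : ∀ x ∈ spectrum ℝ M, q.eval x ≠ 0) : IsUnit (aeval M q) := by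
  have hs : IsSelfAdjoint M := hM
  rw [← cfc_polynomial q M hs]
  exact (isUnit_cfc_iff (fun x => q.eval x) M (by fun_prop) hs).2 h

lemma cfc_quot {n : ℕ} {M : Matrix (Fin n) (Fin n) ℂ} (hM : M.IsHermitian) (p q : ℝ[X])
    (h : ∀ x ∈ spectrum ℝ M, q.eval x ≠ 0) (f : ℝ → ℝ) (hf : Continuous f) :
    hM.cfc f = hM.cfc (fun x => f x - p.eval x / q.eval x) + aeval M p * (aeval M q)⁻¹ := by
  have hs : IsSelfAdjoint M := hM
  have hi : ContinuousOn (fun x => (q.eval x)⁻¹) (spectrum ℝ M) :=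
    ContinuousOn.inv₀ (by fun_prop) h
  rw [← Matrix.IsHermitian.cfc_eq, ← Matrix.IsHermitian.cfc_eq]
  simp only [div_eq_mul_inv]
  rw [cfc_sub f (fun x => p.eval x * (q.eval x)⁻¹) M hf.continuousOn
      (ContinuousOn.mul (by fun_prop) hi),
    cfc_mul (fun x => p.eval x) (fun x => (q.eval x)⁻¹) M (by fun_prop) hi,
    cfc_inv (fun x => q.eval x) M h (by fun_prop) hs, cfc_polynomial p M hs,
    cfc_polynomial q M hs, Matrix.nonsing_inv_eq_ringInverse]
  abel

open scoped Matrix.Norms.L2Operator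

lemma norm_cfc_le' {n : ℕ} {M : Matrix (Fin n) (Fin n) ℂ} (hM : M.IsHermitian) (g : ℝ → ℝ)
    {c : ℝ} (hc : 0 ≤ c) (h : ∀ x ∈ spectrum ℝ M, |g x| ≤ c) : ‖hM.cfc g‖ ≤ c := by
  rw [← Matrix.IsHermitian.cfc_eq]
  exact norm_cfc_le hc h

lemma sqrt_eq {n : ℕ} (x : Fin n → ℂ) :
    Real.sqrt ((star x ⬝ᵥ x).re) = ‖WithLp.toLp 2 x‖ := by
  rw [EuclideanSpace.norm_eq]
  congr 1
  simp [dotProduct, Complex.sq_norm, Complex.normSq_apply]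

lemma specNorm_le {k l : ℕ} (M : Matrix (Fin k) (Fin l) ℂ) : specNorm M ≤ ‖M‖ := by
  refine Real.sSup_le ?_ (norm_nonneg _)
  rintro r ⟨x, hx, rfl⟩
  rw [sqrt_eq]
  have h1 : ‖WithLp.toLp 2 x‖ ≤ 1 := by
    rw [← sqrt_eq]
    exact Real.sqrt_le_one.2 hx
  calc _ ≤ ‖M‖ * ‖WithLp.toLp 2 x‖ := Matrix.l2_opNorm_mulVec M (WithLp.toLp 2 x)
    _ ≤ ‖M‖ * 1 := by gcongr
    _ = _ := mul_one _

lemma norm_iso {n k : ℕ} {U : Matrix (Fin n) (Fin k) ℂ} (hU : Uᴴ * U = 1)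
    (Z : Matrix (Fin k) (Fin k) ℂ) : ‖U * Z * Uᴴ‖ ≤ ‖Z‖ := by
  have h1 : ‖U‖ ≤ 1 := by
    have h2 := Matrix.l2_opNorm_conjTranspose_mul_self U
    rw [hU] at h2
    have h3 : ‖(1 : Matrix (Fin k) (Fin k) ℂ)‖ ≤ 1 := by
      rw [← Matrix.diagonal_one, Matrix.l2_opNorm_diagonal]
      exact (pi_norm_le_iff_of_nonneg zero_le_one).2 fun i => by simp
    nlinarith [norm_nonneg U]
  calc ‖U * Z * Uᴴ‖ ≤ ‖U‖ * ‖Z‖ * ‖Uᴴ‖ :=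
        (Matrix.l2_opNorm_mul _ _).trans
          (mul_le_mul_of_nonneg_right (Matrix.l2_opNorm_mul _ _) (norm_nonneg _))
    _ ≤ 1 * ‖Z‖ * 1 := by
        rw [Matrix.l2_opNorm_conjTranspose]
        gcongr
    _ = ‖Z‖ := by ring

lemma four {n k : ℕ} {U : Matrix (Fin n) (Fin k) ℂ} (hU : Uᴴ * U = 1) {c : ℝ}
    (P Q : Matrix (Fin n) (Fin n) ℂ) (R S : Matrix (Fin k) (Fin k) ℂ)
    (hP : ‖P‖ ≤ c) (hQ : ‖Q‖ ≤ c) (hR : ‖R‖ ≤ c) (hS : ‖S‖ ≤ c) :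
    specNorm (P - Q - U * (R - S) * Uᴴ) ≤ 4 * c := by
  have h1 := specNorm_le (P - Q - U * (R - S) * Uᴴ)
  have h2 := norm_sub_le (P - Q) (U * (R - S) * Uᴴ)
  have h3 := norm_sub_le P Q
  have h4 := norm_sub_le R S
  have h5 := norm_iso hU (R - S)
  linarith

lemma main_bound {n k : ℕ} {A C : Matrix (Fin n) (Fin n) ℂ} (hA : A.IsHermitian)
    (hC : C.IsHermitian) {U : Matrix (Fin n) (Fin k) ℂ} (hU : Uᴴ * U = 1)
    (hAU : (Uᴴ * A * U).IsHermitian) (hCU : (Uᴴ * C * U).IsHermitian)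
    (p q : ℝ[X]) (f : ℝ → ℝ) (hf : Continuous f) (a b : ℝ)
    (hsA : spectrum ℝ A ⊆ Set.Icc a b) (hsC : spectrum ℝ C ⊆ Set.Icc a b)
    (hqzero : ∀ x ∈ Set.Icc a b, q.eval x ≠ 0)
    (hquot : aeval C p * (aeval C q)⁻¹ - aeval A p * (aeval A q)⁻¹ =
      U * (aeval (Uᴴ * C * U) p * (aeval (Uᴴ * C * U) q)⁻¹
        - aeval (Uᴴ * A * U) p * (aeval (Uᴴ * A * U) q)⁻¹) * Uᴴ) :
    specNorm (hC.cfc f - hA.cfc f - U * (hCU.cfc f - hAU.cfc f) * Uᴴ) ≤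
      4 * sSup ((fun x => |f x - p.eval x / q.eval x|) '' Set.Icc a b) := by
  have hsAU := spec_compress hA hU hsA
  have hsCU := spec_compress hC hU hsC
  set c := sSup ((fun x => |f x - p.eval x / q.eval x|) '' Set.Icc a b) with hc
  have hc0 : 0 ≤ c := by
    refine Real.sSup_nonneg ?_
    rintro _ ⟨x, _, rfl⟩
    exact abs_nonneg _
  have hcont : ContinuousOn (fun x => |f x - p.eval x / q.eval x|) (Set.Icc a b) := by
    refine ContinuousOn.abs (hf.continuousOn.sub (ContinuousOn.div ?_ ?_ hqzero)) <;> fun_prop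
  have hle : ∀ x ∈ Set.Icc a b, |f x - p.eval x / q.eval x| ≤ c := fun x hx =>
    le_csSup (isCompact_Icc.image_of_continuousOn hcont).bddAbove ⟨x, hx, rfl⟩
  have e : hC.cfc f - hA.cfc f - U * (hCU.cfc f - hAU.cfc f) * Uᴴ =
      hC.cfc (fun x => f x - p.eval x / q.eval x) - hA.cfc (fun x => f x - p.eval x / q.eval x) -
      U * (hCU.cfc (fun x => f x - p.eval x / q.eval x) -
        hAU.cfc (fun x => f x - p.eval x / q.eval x)) * Uᴴ := by
    rw [cfc_quot hC p q (fun x hx => hqzero x (hsC hx)) f hf,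
      cfc_quot hA p q (fun x hx => hqzero x (hsA hx)) f hf,
      cfc_quot hCU p q (fun x hx => hqzero x (hsCU hx)) f hf,
      cfc_quot hAU p q (fun x hx => hqzero x (hsAU hx)) f hf]
    rw [add_sub_add_comm, add_sub_add_comm, hquot, Matrix.mul_add, Matrix.add_mul]
    abel
  rw [e]
  exact four hU _ _ _ _
    (norm_cfc_le' hC _ hc0 fun x hx => hle x (hsC hx))
    (norm_cfc_le' hA _ hc0 fun x hx => hle x (hsA hx))
    (norm_cfc_le' hCU _ hc0 fun x hx => hle x (hsCU hx))
    (norm_cfc_le' hAU _ hc0 fun x hx => hle x (hsAU hx))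

end analysis

end RK

/-- convergence bound for the rational Krylov update of a Hermitian matrix
(Theorem 4.5 of the paper): the error is bounded by
`4 inf_{p ∈ Π_m} sup_{x ∈ [a,b]} |f(x) − p(x)/q_m(x)|`. -/
theorem stmt12 (n ℓ m k : ℕ) (A : Matrix (Fin n) (Fin n) ℂ) (hA : A.IsHermitian)
    (B : Matrix (Fin n) (Fin ℓ) ℂ) (J : Matrix (Fin ℓ) (Fin ℓ) ℂ) (hJ : J.IsHermitian)
    (ξ : Fin m → ℝ) (q : Polynomial ℝ) (hqdef : q = ∏ i, (X - Polynomial.C (ξ i)))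
    (hqA : IsUnit (aeval A q))
    (U : Matrix (Fin n) (Fin k) ℂ)
    (hU : IsOrthonormalBasisOf U
      ((Krylov m A B).map ((aeval A q)⁻¹).mulVecLin))
    (a b : ℝ)
    (heigA : ∀ i, hA.eigenvalues i ∈ Set.Icc a b)
    (heigAD : ∀ i,
      (hA.add (isHermitian_mul_mul_conjTranspose B hJ)).eigenvalues i ∈ Set.Icc a b)
    (hqzero : ∀ x ∈ Set.Icc a b, q.eval x ≠ 0) :
    ∀ f : ℝ → ℝ, Continuous f →
      specNorm ((hA.add (isHermitian_mul_mul_conjTranspose B hJ)).cfc f - hA.cfc f -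
          U * ((isHermitian_conjTranspose_mul_mul U
                  (hA.add (isHermitian_mul_mul_conjTranspose B hJ))).cfc f -
                (isHermitian_conjTranspose_mul_mul U hA).cfc f) * Uᴴ) ≤
        4 * sInf {t : ℝ | ∃ p : Polynomial ℝ, p.degree ≤ (m : ℕ) ∧
          t = sSup ((fun x => |f x - p.eval x / q.eval x|) '' Set.Icc a b)} := by
  intro f hf
  have hC := hA.add (isHermitian_mul_mul_conjTranspose B hJ)
  have hsA : spectrum ℝ A ⊆ Set.Icc a b := by
    rw [hA.spectrum_real_eq_range_eigenvalues]
    rintro _ ⟨i, rfl⟩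
    exact heigA i
  have hsC : spectrum ℝ (A + B * J * Bᴴ) ⊆ Set.Icc a b := by
    rw [(hA.add (isHermitian_mul_mul_conjTranspose B hJ)).spectrum_real_eq_range_eigenvalues]
    rintro _ ⟨i, rfl⟩
    exact heigAD i
  have hq : q.natDegree ≤ m := by
    rw [hqdef, Polynomial.natDegree_prod_of_monic _ _ (fun i _ => monic_X_sub_C _)]
    simp
  have hCq := RK.unit_aeval hC q fun x hx => hqzero x (hsC hx)
  have hAUq := RK.unit_aeval (isHermitian_conjTranspose_mul_mul U hA) q
    fun x hx => hqzero x (RK.spec_compress hA hU.1 hsA hx)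
  have hCUq := RK.unit_aeval (isHermitian_conjTranspose_mul_mul U hC) q
    fun x hx => hqzero x (RK.spec_compress hC hU.1 hsC hx)
  rw [mul_comm (4 : ℝ), ← div_le_iff₀ (by norm_num)]
  refine le_csInf ⟨_, 0, by simp, rfl⟩ ?_
  rintro t ⟨p, hp, rfl⟩
  rw [div_le_iff₀ (by norm_num), mul_comm _ (4 : ℝ)]
  refine RK.main_bound hA _ hU.1 _ _ p q f hf a b hsA hsC hqzero ?_
  refine RK.quot A hA B J _ rfl U p q (natDegree_le_of_degree_le hp) hq hqA hAUq hCq hCUq ?_ ?_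
  · intro j hj
    exact RK.proj hU _ fun l => RK.mem_map _ _ _ (RK.krylov_col A B j hj) l
  · intro j hj
    exact RK.proj hU _ fun l => RK.memC A B J _ rfl q hq hqA hCq j hj l
end
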